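/- Let R be a Cohen-Macaulay local ring with canonical module ω_R, a a Cohen-Macaulay quasi-Gorenstein ideal, and R̄ = R/a. (1) If M is a Cohen-Macaulay R-module lying in the Auslander class A_{ω_R} which is linked by the ideal a (in the sense of Martsinkovsky–Strooker), then N := M ⊗_{R̄} ω_{R̄} is a Cohen-Macaulay R-module lying in the Bass class B_{ω_R} which is linked by the ideal a with respect to ω_{R̄}, and Hom_{R̄}(ω_{R̄}, N) ≅ M. (2) Conversely, if N is a Cohen-Macaulay R-module in B_{ω_R} which is linked by a with respect to ω_{R̄}, then M := Hom_{R̄}(ω_{R̄}, N) is a Cohen-Macaulay R-module in A_{ω_R} which is linked by the ideal a, and M ⊗_{R̄} ω_{R̄} ≅ N. -/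

import Mathlib

/- Preliminary definitions for formalizing
   "Linkage of modules with respect to a semidualizing module"
   (Dibaei–Sadeghi). -/

open CategoryTheory

universe u
noncomputable section
namespace Paper

variable (R : Type u) [CommRing R]

/-- `Ext^i_R(M,N)`, realized via Mathlib's derived-functor `Ext` for the
`R`-linear abelian category of `R`-modules. -/
abbrev ExtGrp (M N : Type u) [AddCommGroup M] [Module R M] [AddCommGroup N] [Module R N]
    (i : ℕ) : Type u :=
  ((Ext R (ModuleCat.{u} R) i).obj (Opposite.op (ModuleCat.of R M))).obj (ModuleCat.of R N)

/-- `Tor^R_i(M,N)`. -/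
abbrev TorGrp (M N : Type u) [AddCommGroup M] [Module R M] [AddCommGroup N] [Module R N]
    (i : ℕ) : Type u :=
  ((Tor (ModuleCat.{u} R) i).obj (ModuleCat.of R M)).obj (ModuleCat.of R N)

/-- Local cohomology `H^i_I(M)`. -/
abbrev LocCoh (I : Ideal R) (i : ℕ) (M : Type u) [AddCommGroup M] [Module R M] : Type u :=
  (localCohomology I i).obj (ModuleCat.of R M)

/-- A commutative ring is semiperfect iff it is a finite direct product of
commutative local rings. -/
def IsSemiperfectRing : Prop :=
  ∃ (n : ℕ) (A : Fin n → Type u) (c : ∀ i, CommRing (A i)),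
    (∀ i, letI := c i; IsLocalRing (A i)) ∧
    (letI := c; Nonempty (R ≃+* ((i : Fin n) → A i)))

/-- `C` is a semidualizing `R`-module: `C` is finitely generated, the homothety map
`R → Hom_R(C,C)` is bijective, and `Ext^i_R(C,C) = 0` for all `i > 0`. -/
def IsSemidualizing (C : Type u) [AddCommGroup C] [Module R C] : Prop :=
  Module.Finite R C ∧
  Function.Bijective (LinearMap.lsmul R C) ∧
  ∀ i : ℕ, 0 < i → Subsingleton (ExtGrp R C C i)

/-- A minimal projective presentation `P₁ → P₀ → M → 0` of `M`:
both `P₀ → M` and the induced `P₁ → ker(P₀ → M)` are projective covers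
(surjections from finitely generated projectives with superfluous kernels). -/
structure MinPres (M : Type u) [AddCommGroup M] [Module R M] where
  P₁ : Type u
  P₀ : Type u
  [acg₁ : AddCommGroup P₁]
  [acg₀ : AddCommGroup P₀]
  [mod₁ : Module R P₁]
  [mod₀ : Module R P₀]
  f : P₁ →ₗ[R] P₀
  g : P₀ →ₗ[R] M
  finite₁ : Module.Finite R P₁
  finite₀ : Module.Finite R P₀
  proj₁ : Module.Projective R P₁
  proj₀ : Module.Projective R P₀
  surj : Function.Surjective g
  exact : LinearMap.range f = LinearMap.ker g
  min₀ : ∀ N : Submodule R P₀, N ⊔ LinearMap.ker g = ⊤ → N = ⊤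
  min₁ : ∀ N : Submodule R P₁, N ⊔ LinearMap.ker f = ⊤ → N = ⊤

attribute [instance] MinPres.acg₁ MinPres.acg₀ MinPres.mod₁ MinPres.mod₀

variable {R}

/-- Given a minimal presentation `P₁ --f--> P₀ → X → 0` this is
`Hom(f,C) : Hom_R(P₀,C) → Hom_R(P₁,C)`; its image is `Ω_C Tr_C X` and its
cokernel is the transpose `Tr_C X` of `X` with respect to `C`. -/
def MinPres.homC {X : Type u} [AddCommGroup X] [Module R X]
    (C : Type u) [AddCommGroup C] [Module R C] (pres : MinPres R X) :
    (pres.P₀ →ₗ[R] C) →ₗ[R] (pres.P₁ →ₗ[R] C) :=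
  LinearMap.lcomp R C pres.f

/-- `Tr_C X` computed from a given minimal presentation. -/
def MinPres.trC {X : Type u} [AddCommGroup X] [Module R X]
    (C : Type u) [AddCommGroup C] [Module R C] (pres : MinPres R X) : Type u :=
  (pres.P₁ →ₗ[R] C) ⧸ LinearMap.range (pres.homC C)

instance {X : Type u} [AddCommGroup X] [Module R X] (C : Type u) [AddCommGroup C] [Module R C]
    (pres : MinPres R X) : AddCommGroup (pres.trC C) :=
  inferInstanceAs (AddCommGroup ((pres.P₁ →ₗ[R] C) ⧸ LinearMap.range (pres.homC C)))

instance {X : Type u} [AddCommGroup X] [Module R X] (C : Type u) [AddCommGroup C] [Module R C]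
    (pres : MinPres R X) : Module R (pres.trC C) :=
  inferInstanceAs (Module R ((pres.P₁ →ₗ[R] C) ⧸ LinearMap.range (pres.homC C)))

variable (R)

/-- `N ≅ Ω_C Tr_C X` : `N` is (isomorphic to) the image of `Hom(f,C)` for a
minimal projective presentation `P₁ --f--> P₀ → X → 0` of `X`. -/
def IsOmegaTrC (C : Type u) [AddCommGroup C] [Module R C]
    (X : Type u) [AddCommGroup X] [Module R X]
    (N : Type u) [AddCommGroup N] [Module R N] : Prop :=
  ∃ pres : MinPres R X, Nonempty (N ≃ₗ[R] ↥(LinearMap.range (pres.homC C)))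

/-- `N ≅ λ_R(C,M) = Ω_C Tr_C (Hom_R(C,M))`. -/
def IsLambdaOf (C : Type u) [AddCommGroup C] [Module R C]
    (M : Type u) [AddCommGroup M] [Module R M]
    (N : Type u) [AddCommGroup N] [Module R N] : Prop :=
  IsOmegaTrC R C (C →ₗ[R] M) N

/-- `M` is horizontally linked with respect to `C` : `M ≅ λ_R(C, λ_R(C,M))`. -/
def IsHorizontallyLinked (C : Type u) [AddCommGroup C] [Module R C]
    (M : Type u) [AddCommGroup M] [Module R M] : Prop :=
  ∃ N : ModuleCat.{u} R, IsLambdaOf R C M N ∧ IsLambdaOf R C N M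

/-- `M` is horizontally linked in the sense of Martsinkovsky–Strooker:
`M ≅ λ(λ M)` where `λ = Ω Tr`. -/
def IsHorizontallyLinkedMS (M : Type u) [AddCommGroup M] [Module R M] : Prop :=
  ∃ N : ModuleCat.{u} R, IsOmegaTrC R R M N ∧ IsOmegaTrC R R N M

/-- `underline-Hom_R(M,N) = 0` : every homomorphism `M → N` factors through a
projective module. -/
def StableHomZero (M N : Type u) [AddCommGroup M] [Module R M]
    [AddCommGroup N] [Module R N] : Prop :=
  ∀ φ : M →ₗ[R] N, ∃ P : ModuleCat.{u} R, Module.Projective R P ∧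
    ∃ (α : M →ₗ[R] P) (β : (P : Type u) →ₗ[R] N), β ∘ₗ α = φ

/-- `M` is `C`-stable: `M` has no nonzero direct summand of the form `P ⊗_R C`
with `P` projective. -/
def IsCStable (C M : Type u) [AddCommGroup C] [Module R C]
    [AddCommGroup M] [Module R M] : Prop :=
  ∀ N₁ N₂ : Submodule R M, IsCompl N₁ N₂ →
    ∀ P : ModuleCat.{u} R, Module.Projective R P →
      Nonempty (↥N₁ ≃ₗ[R] TensorProduct R P C) → N₁ = ⊥

/-- `M` is a `C`-syzygy: `M` embeds into a module `P ⊗_R C` with `P` projective. -/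
def IsCSyzygy (C M : Type u) [AddCommGroup C] [Module R C]
    [AddCommGroup M] [Module R M] : Prop :=
  ∃ P : ModuleCat.{u} R, Module.Projective R P ∧
    ∃ ι : M →ₗ[R] TensorProduct R (P : Type u) C, Function.Injective ι

/-- Auxiliary recursion for `n`-th `C`-syzygies. -/
def IsNthCSyzygyAux (C : Type u) [AddCommGroup C] [Module R C] :
    ℕ → ModuleCat.{u} R → Prop
  | 0, _ => True
  | (m+1), M =>
    ∃ P : ModuleCat.{u} R, Module.Projective R P ∧
      ∃ ι : (M : Type u) →ₗ[R] TensorProduct R (P : Type u) C, Function.Injective ι ∧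
        IsNthCSyzygyAux C m
          (ModuleCat.of R (TensorProduct R (P : Type u) C ⧸ LinearMap.range ι))

/-- `M` is an `n`-th `C`-syzygy: there is an exact sequence
`0 → M → C₁ → ⋯ → C_n` with each `C_j` of the form `P_j ⊗_R C`, `P_j` projective. -/
def IsNthCSyzygy (n : ℕ) (C M : Type u) [AddCommGroup C] [Module R C]
    [AddCommGroup M] [Module R M] : Prop :=
  IsNthCSyzygyAux R C n (ModuleCat.of R M)

/-- The biduality map `M → Hom_R(Hom_R(M,C),C)`. -/
def bidualityMap (C M : Type u) [AddCommGroup C] [Module R C]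
    [AddCommGroup M] [Module R M] : M →ₗ[R] ((M →ₗ[R] C) →ₗ[R] C) :=
  (LinearMap.id : (M →ₗ[R] C) →ₗ[R] (M →ₗ[R] C)).flip

/-- `M` has `G_C`-dimension zero. -/
def GCdimZero (C M : Type u) [AddCommGroup C] [Module R C]
    [AddCommGroup M] [Module R M] : Prop :=
  Module.Finite R M ∧
  Function.Bijective (bidualityMap R C M) ∧
  (∀ i : ℕ, 0 < i → Subsingleton (ExtGrp R M C i)) ∧
  (∀ i : ℕ, 0 < i → Subsingleton (ExtGrp R (M →ₗ[R] C) C i))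

/-- `G_C`-dim`_R(M) ≤ n`: there is a resolution of `M` of length `≤ n` by modules of
`G_C`-dimension zero. -/
def GCdimLE (C M : Type u) [AddCommGroup C] [Module R C]
    [AddCommGroup M] [Module R M] (n : ℕ) : Prop :=
  ∃ (G : ℕ → ModuleCat.{u} R) (d : ∀ i : ℕ, (G (i+1) : Type u) →ₗ[R] G i)
    (ε : (G 0 : Type u) →ₗ[R] M),
    Function.Surjective ε ∧
    LinearMap.range (d 0) = LinearMap.ker ε ∧
    (∀ i : ℕ, LinearMap.range (d (i+1)) = LinearMap.ker (d i)) ∧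
    (∀ i : ℕ, GCdimZero R C (G i)) ∧
    (∀ i : ℕ, n < i → Subsingleton (G i))

/-- `G_C`-dim`_R(M) < ∞`. -/
def GCdimFinite (C M : Type u) [AddCommGroup C] [Module R C]
    [AddCommGroup M] [Module R M] : Prop :=
  ∃ n : ℕ, GCdimLE R C M n

/-- The "depth of `I` on `M`" (classical grade): `inf{ i | Ext^i_R(R/I, M) ≠ 0 }`,
as an extended natural number. -/
def edepth (I : Ideal R) (M : Type u) [AddCommGroup M] [Module R M] : ℕ∞ :=
  sInf {n : ℕ∞ | ∃ i : ℕ, n = i ∧ Nontrivial (ExtGrp R (R ⧸ I) M i)}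

/-- The depth of a module over a local ring. -/
def ldepth [IsLocalRing R] (M : Type u) [AddCommGroup M] [Module R M] : ℕ∞ :=
  edepth R (IsLocalRing.maximalIdeal R) M

/-- `depth_{R_p}(M_p)`. -/
def depthAt (p : Ideal R) [p.IsPrime] (M : Type u) [AddCommGroup M] [Module R M] : ℕ∞ :=
  ldepth (Localization.AtPrime p) (LocalizedModule p.primeCompl M)

/-- `depth R_p`. -/
def ringDepthAt (p : Ideal R) [p.IsPrime] : ℕ∞ :=
  ldepth (Localization.AtPrime p) (Localization.AtPrime p)

/-- Serre's condition `(S̃_n)`: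
`depth_{R_p}(M_p) ≥ min{n, depth R_p}` for all primes `p`. -/
def SerreTilde (n : ℕ) (M : Type u) [AddCommGroup M] [Module R M] : Prop :=
  ∀ (p : Ideal R) (_ : p.IsPrime), min (n : ℕ∞) (ringDepthAt R p) ≤ depthAt R p M

/-- Serre's condition `(S_n)`:
`depth_{R_p}(M_p) ≥ min{n, dim R_p}` for all primes `p`. -/
def SerreS (n : ℕ) (M : Type u) [AddCommGroup M] [Module R M] : Prop :=
  ∀ (p : Ideal R) (_ : p.IsPrime),
    min (n : WithBot ℕ∞) (ringKrullDim (Localization.AtPrime p)) ≤ (depthAt R p M : WithBot ℕ∞)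

/-- The dimension of a module: `dim_R(M) = dim (R / ann_R M)`. -/
def moduleDim (M : Type u) [AddCommGroup M] [Module R M] : WithBot ℕ∞ :=
  ringKrullDim (R ⧸ Module.annihilator R M)

/-- A Cohen-Macaulay module over a local ring: `depth_R(M) = dim_R(M)`. -/
def IsCMModule [IsLocalRing R] (M : Type u) [AddCommGroup M] [Module R M] : Prop :=
  (ldepth R M : WithBot ℕ∞) = moduleDim R M

/-- A maximal Cohen-Macaulay module over a local ring: `depth_R(M) = dim R`. -/
def IsMaximalCM [IsLocalRing R] (M : Type u) [AddCommGroup M] [Module R M] : Prop :=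
  (ldepth R M : WithBot ℕ∞) = ringKrullDim R

/-- A Cohen-Macaulay local ring. -/
def IsCMLocalRing : Prop :=
  ∃ _ : IsLocalRing R, (ldepth R R : WithBot ℕ∞) = ringKrullDim R

/-- `C` has finite injective dimension: for some `n`, `Ext^i_R(-,C)` vanishes
for all `i > n`. -/
def HasFiniteInjDim (C : Type u) [AddCommGroup C] [Module R C] : Prop :=
  ∃ n : ℕ, ∀ (M : ModuleCat.{u} R) (i : ℕ), n < i →
    Subsingleton (((Ext R (ModuleCat.{u} R) i).obj (Opposite.op M)).obj (ModuleCat.of R C))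

/-- `ω` is a canonical module of `R`: a semidualizing module of finite injective
dimension. -/
def IsCanonicalModule (ω : Type u) [AddCommGroup ω] [Module R ω] : Prop :=
  IsSemidualizing R ω ∧ HasFiniteInjDim R ω

/-- `Gid_R(M) ≤ n`: there is an exact complex `⋯ → I_1 → I_0 → I_{-1} → ⋯` of
injective modules, which stays exact under `Hom_R(E,-)` for every injective `E`,
with `M ≅ ker(I_0 → I_{-1})` and `I_j = 0` for `j < -n`. -/
def GidLE (M : Type u) [AddCommGroup M] [Module R M] (n : ℕ) : Prop :=
  ∃ (I : ℤ → ModuleCat.{u} R) (d : ∀ i : ℤ, (I (i+1) : Type u) →ₗ[R] I i),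
    (∀ i : ℤ, Module.Injective R (I i)) ∧
    (∀ i : ℤ, LinearMap.range (d (i+1)) = LinearMap.ker (d i)) ∧
    (∀ E : ModuleCat.{u} R, Module.Injective R E →
      ∀ (i : ℤ) (φ : (E : Type u) →ₗ[R] I (i+1)), d i ∘ₗ φ = 0 →
        ∃ ψ : (E : Type u) →ₗ[R] I (i+1+1), d (i+1) ∘ₗ ψ = φ) ∧
    Nonempty (M ≃ₗ[R] ↥(LinearMap.ker (d (-1)))) ∧
    (∀ i : ℤ, i < -(n : ℤ) → Subsingleton (I i))

/-- `M` has finite Gorenstein injective dimension. -/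
def HasFiniteGid (M : Type u) [AddCommGroup M] [Module R M] : Prop :=
  ∃ n : ℕ, GidLE R M n

/-- The evaluation map `C ⊗_R Hom_R(C,M) → M`. -/
def evalMap (C M : Type u) [AddCommGroup C] [Module R C]
    [AddCommGroup M] [Module R M] : TensorProduct R C (C →ₗ[R] M) →ₗ[R] M :=
  TensorProduct.lift ((LinearMap.id : (C →ₗ[R] M) →ₗ[R] (C →ₗ[R] M)).flip)

/-- Membership in the Bass class `B_C`. -/
def MemBass (C M : Type u) [AddCommGroup C] [Module R C]
    [AddCommGroup M] [Module R M] : Prop :=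
  Function.Bijective (evalMap R C M) ∧
  (∀ i : ℕ, 0 < i → Subsingleton (TorGrp R (C →ₗ[R] M) C i)) ∧
  (∀ i : ℕ, 0 < i → Subsingleton (ExtGrp R C M i))

/-- Membership in the Auslander class `A_C`. -/
def MemAus (C M : Type u) [AddCommGroup C] [Module R C]
    [AddCommGroup M] [Module R M] : Prop :=
  Function.Bijective (TensorProduct.mk R M C) ∧
  (∀ i : ℕ, 0 < i → Subsingleton (TorGrp R M C i)) ∧
  (∀ i : ℕ, 0 < i → Subsingleton (ExtGrp R C (TensorProduct R M C) i))

/-- The grade of a module: the common length of maximal `R`-regular sequences in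
`ann_R(M)`, i.e. `inf{ i | Ext^i(R/ann M, R) ≠ 0 }`. -/
def gradeMod (M : Type u) [AddCommGroup M] [Module R M] : ℕ∞ :=
  edepth R (Module.annihilator R M) R

/-- The grade of an ideal `I`, i.e. `grade_R(R/I)`. -/
def gradeIdeal (I : Ideal R) : ℕ∞ :=
  edepth R I R

/-- An unmixed ideal: every associated prime of `R/I` is a minimal prime of `I`. -/
def IsUnmixedIdeal (I : Ideal R) : Prop :=
  ∀ p ∈ associatedPrimes R (R ⧸ I), p ∈ I.minimalPrimes

/-- Equality of the `a`-th Bass number of `R` (over `R`, w.r.t. the maximal ideal `m`)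
and the `b`-th Bass number of `A` (over `A`, w.r.t. the maximal ideal `mA`): both Ext
modules are vector spaces over the corresponding residue fields of one and the same
dimension. -/
def BassNumbersEq (m : Ideal R) (a : ℕ) (A : Type u) [CommRing A] (mA : Ideal A) (b : ℕ) : Prop :=
  ∃ ι : Type u,
    Nonempty (ExtGrp R (R ⧸ m) R a ≃ₗ[R] (ι →₀ (R ⧸ m))) ∧
    Nonempty (ExtGrp A (A ⧸ mA) A b ≃ₗ[A] (ι →₀ (A ⧸ mA)))

/-- A quasi-Gorenstein ideal of a local ring `R`: `G-dim_R(R/a) < ∞` and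
`μ^{i+depth R}_R(R) = μ^{i+depth R/a}_{R/a}(R/a)` for all `i ≥ 0`. -/
def IsQuasiGorensteinIdeal [IsLocalRing R] (a : Ideal R) : Prop :=
  GCdimFinite R R (R ⧸ a) ∧
  ∀ i : ℕ,
    BassNumbersEq R (IsLocalRing.maximalIdeal R) (i + (ldepth R R).toNat)
      (R ⧸ a) (Ideal.map (Ideal.Quotient.mk a) (IsLocalRing.maximalIdeal R))
      (i + (edepth (R ⧸ a) (Ideal.map (Ideal.Quotient.mk a) (IsLocalRing.maximalIdeal R))
        (R ⧸ a)).toNat)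

/-- `E` is an injective hull of `K`: `E` is injective and contains a copy of `K`
as an essential submodule. -/
def IsInjectiveHull (K E : Type u) [AddCommGroup K] [Module R K]
    [AddCommGroup E] [Module R E] : Prop :=
  Module.Injective R E ∧
  ∃ ι : K →ₗ[R] E, Function.Injective ι ∧
    ∀ N : Submodule R E, N ≠ ⊥ → N ⊓ LinearMap.range ι ≠ ⊥

/-- A generalized Cohen-Macaulay module over a local ring: `dim M ≥ 1` and
`H^i_m(M)` has finite length for all `i < dim M`. -/
def IsGeneralizedCM [IsLocalRing R] (M : Type u) [AddCommGroup M] [Module R M] : Prop :=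
  1 ≤ moduleDim R M ∧
  ∀ i : ℕ, (i : WithBot ℕ∞) < moduleDim R M →
    IsFiniteLength R (LocCoh R (IsLocalRing.maximalIdeal R) i M)

end Paper

namespace Linkage

open Paper TensorProduct
open scoped Pointwise

section ExtComparison

variable {R : Type u} [CommRing R]

/-- Vanishing of `Ext^i_R(M,N)`, phrased with the derived-category `Ext`. -/
abbrev EV (R : Type u) [CommRing R] (M N : Type u) [AddCommGroup M] [Module R M]
    [AddCommGroup N] [Module R N] (i : ℕ) : Prop :=
  Subsingleton (Abelian.Ext (ModuleCat.of R M) (ModuleCat.of R N) i)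

lemma extMk_smul {X Y : ModuleCat.{u} R} (P : ProjectiveResolution X) {n m : ℕ} (r : R)
    (f : P.complex.X n ⟶ Y) (hm : n + 1 = m) (hf : P.complex.d m n ≫ f = 0) :
    P.extMk (r • f) m hm (by simp [hf]) = r • P.extMk f m hm hf := by
  rw [Abelian.Ext.smul_eq_comp_mk₀, ProjectiveResolution.extMk_comp_mk₀]
  congr 1

def cocycleToExt {X : ModuleCat.{u} R} (P : ProjectiveResolution X) (Y : ModuleCat.{u} R) (n : ℕ) :
    LinearMap.ker ((P.complex.linearYonedaObj R Y).d n (n + 1)).hom →ₗ[R]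
      Abelian.Ext X Y n where
  toFun f := P.extMk (f.1 : P.complex.X n ⟶ Y) (n + 1) rfl f.2
  map_add' f g := (P.add_extMk (f.1 : P.complex.X n ⟶ Y) g.1 (n + 1) rfl f.2 g.2).symm
  map_smul' r f := extMk_smul P r (f.1 : P.complex.X n ⟶ Y) rfl f.2

lemma cocycleToExt_surjective {X : ModuleCat.{u} R} (P : ProjectiveResolution X)
    (Y : ModuleCat.{u} R) (n : ℕ) : Function.Surjective (cocycleToExt P Y n) := by
  intro α
  obtain ⟨f, hf, h⟩ := P.extMk_surjective α (n + 1) rfl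
  exact ⟨⟨f, hf⟩, h⟩

lemma extMk_zero_injective {X : ModuleCat.{u} R} (P : ProjectiveResolution X)
    (Y : ModuleCat.{u} R) (f : P.complex.X 0 ⟶ Y) (hf : P.complex.d 1 0 ≫ f = 0)
    (h : P.extMk f 1 rfl hf = 0) : f = 0 := by
  have h' := congrArg P.extEquivCohomologyClass h
  simp only [ProjectiveResolution.extEquivCohomologyClass_extMk,
    ProjectiveResolution.extEquivCohomologyClass_zero,
    CochainComplex.HomComplex.CohomologyClass.mk_eq_zero_iff] at h'
  rw [CochainComplex.HomComplex.Cocycle.toSingleMk_mem_coboundaries_iff _ _ _ _ _ 1 (by lia)] at h'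
  obtain ⟨g, hg⟩ := h'
  have hz : g = 0 := Limits.IsZero.eq_zero_of_src
    (CochainComplex.isZero_of_isStrictlyLE _ 0 1 (by lia)) g
  rw [hz] at hg
  simp only [Limits.comp_zero] at hg
  rw [← cancel_epi (P.cochainComplexXIso (-(0:ℕ)) 0 rfl).hom, ← hg]
  simp

lemma ker_cocycleToExt {X : ModuleCat.{u} R} (P : ProjectiveResolution X)
    (Y : ModuleCat.{u} R) (n : ℕ) :
    LinearMap.ker (cocycleToExt P Y n) =
      LinearMap.range (((P.complex.linearYonedaObj R Y).sc' ((ComplexShape.up ℕ).prev n) n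
        (n + 1)).moduleCatToCycles) := by
  ext ⟨f, hf⟩
  rw [LinearMap.mem_ker]
  change P.extMk f (n + 1) rfl hf = 0 ↔ _
  rcases n with _ | p
  · constructor
    · intro h
      refine ⟨0, ?_⟩
      rw [map_zero]
      exact Subtype.ext (extMk_zero_injective P Y f hf h).symm
    · rintro ⟨g, hg⟩
      have h1 : f = 0 := by
        refine (congrArg Subtype.val hg).symm.trans ?_
        change ((P.complex.linearYonedaObj R Y).d ((ComplexShape.up ℕ).prev 0) 0).hom g = 0
        rw [HomologicalComplex.shape]
        · rfl
        · simp
      subst h1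
      exact P.extMk_zero _ _
  · have hp : (ComplexShape.up ℕ).prev (p + 1) = p := by simp
    rw [hp, P.extMk_eq_zero_iff f (p + 1 + 1) rfl hf p rfl]
    constructor
    · rintro ⟨g, hg⟩
      exact ⟨g, Subtype.ext hg⟩
    · rintro ⟨g, hg⟩
      exact ⟨g, congrArg Subtype.val hg⟩

/-- The derived functor `Ext` agrees with the derived-category `Ext`. -/
def extGrpEquiv (M N : Type u) [AddCommGroup M] [Module R M] [AddCommGroup N] [Module R N]
    (n : ℕ) : ExtGrp R M N n ≃ₗ[R] Abelian.Ext (ModuleCat.of R M) (ModuleCat.of R N) n :=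
  let P := projectiveResolution (ModuleCat.of R M)
  let K := P.complex.linearYonedaObj R (ModuleCat.of R N)
  let e₁ := (P.isoExt (R := R) n (ModuleCat.of R N)).toLinearEquiv
  let e₂ := (ShortComplex.homologyMapIso
    (K.isoSc' ((ComplexShape.up ℕ).prev n) n (n + 1) rfl (by simp))).toLinearEquiv
  let e₃ := (K.sc' ((ComplexShape.up ℕ).prev n) n (n + 1)).moduleCatHomologyIso.toLinearEquiv
  let e₄ : (LinearMap.ker (K.d n (n + 1)).hom ⧸ LinearMap.range ((K.sc' ((ComplexShape.up ℕ).prev n)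
      n (n + 1)).moduleCatToCycles)) ≃ₗ[R]
      (LinearMap.ker (K.d n (n + 1)).hom ⧸ LinearMap.ker (cocycleToExt P (ModuleCat.of R N) n)) :=
    Submodule.quotEquivOfEq _ _ (ker_cocycleToExt P _ n).symm
  let e₅ := (cocycleToExt P _ n).quotKerEquivOfSurjective
    (cocycleToExt_surjective P (ModuleCat.of R N) n)
  (e₁.trans (e₂.trans e₃)).trans (e₄.trans e₅)

lemma subsingleton_extGrp_iff (M N : Type u) [AddCommGroup M] [Module R M] [AddCommGroup N]
    [Module R N] (n : ℕ) : Subsingleton (ExtGrp R M N n) ↔ EV R M N n :=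
  (extGrpEquiv M N n).toEquiv.subsingleton_congr

end ExtComparison

section ExtSequences

variable {R : Type u} [CommRing R]
variable {A B C N M : Type u} [AddCommGroup A] [Module R A] [AddCommGroup B] [Module R B]
  [AddCommGroup C] [Module R C] [AddCommGroup N] [Module R N] [AddCommGroup M] [Module R M]

/-- A short exact sequence `0 → A → B → C → 0` of linear maps. -/
structure SES (f : A →ₗ[R] B) (g : B →ₗ[R] C) : Prop where
  inj : Function.Injective f
  surj : Function.Surjective g
  exact : Function.Exact f g

namespace SES

variable {f : A →ₗ[R] B} {g : B →ₗ[R] C}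

/-- The short complex of modules attached to a short exact sequence. -/
abbrev complex (h : SES f g) : ShortComplex (ModuleCat.{u} R) :=
  ShortComplex.mk (ModuleCat.ofHom f) (ModuleCat.ofHom g) (by
    ext x; exact h.exact.apply_apply_eq_zero x)

lemma shortExact (h : SES f g) : h.complex.ShortExact := by
  refine ShortComplex.ShortExact.mk' ?_ ?_ ?_
  · rw [ShortComplex.ShortExact.moduleCat_exact_iff_function_exact]
    exact h.exact
  · exact (ModuleCat.mono_iff_injective _).2 h.inj
  · exact (ModuleCat.epi_iff_surjective _).2 h.surj

lemma cov₂ (h : SES f g) {i : ℕ} (h1 : EV R M A i) (h3 : EV R M C i) : EV R M B i := by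
  refine subsingleton_of_forall_eq 0 fun x => ?_
  obtain ⟨y, rfl⟩ := Abelian.Ext.covariant_sequence_exact₂ (ModuleCat.of R M) h.shortExact x
    (h3.elim _ _)
  rw [show y = 0 from h1.elim _ _, Abelian.Ext.zero_comp]

lemma cov₁ (h : SES f g) {i : ℕ} (h3 : EV R M C i) (h2 : EV R M B (i + 1)) :
    EV R M A (i + 1) := by
  refine subsingleton_of_forall_eq 0 fun x => ?_
  obtain ⟨y, rfl⟩ := Abelian.Ext.covariant_sequence_exact₁ (ModuleCat.of R M) h.shortExact x
    (h2.elim _ _) rfl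
  rw [show y = 0 from h3.elim _ _, Abelian.Ext.zero_comp]

lemma cov₃ (h : SES f g) {i : ℕ} (h2 : EV R M B i) (h1 : EV R M A (i + 1)) :
    EV R M C i := by
  refine subsingleton_of_forall_eq 0 fun x => ?_
  obtain ⟨y, rfl⟩ := Abelian.Ext.covariant_sequence_exact₃ (ModuleCat.of R M) h.shortExact x
    rfl (h1.elim _ _)
  rw [show y = 0 from h2.elim _ _, Abelian.Ext.zero_comp]

lemma con₂ (h : SES f g) {i : ℕ} (h1 : EV R A N i) (h3 : EV R C N i) : EV R B N i := by
  refine subsingleton_of_forall_eq 0 fun x => ?_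
  obtain ⟨y, rfl⟩ := Abelian.Ext.contravariant_sequence_exact₂ h.shortExact (ModuleCat.of R N) x
    (h1.elim _ _)
  rw [show y = 0 from h3.elim _ _, Abelian.Ext.comp_zero]

lemma con₁ (h : SES f g) {i : ℕ} (h2 : EV R B N i) (h3 : EV R C N (i + 1)) :
    EV R A N i := by
  refine subsingleton_of_forall_eq 0 fun x => ?_
  obtain ⟨y, rfl⟩ := Abelian.Ext.contravariant_sequence_exact₁ h.shortExact (ModuleCat.of R N) x
    (Nat.add_comm 1 i) (h3.elim _ _)
  rw [show y = 0 from h2.elim _ _, Abelian.Ext.comp_zero]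

lemma con₃ (h : SES f g) {i : ℕ} (h1 : EV R A N i) (h2 : EV R B N (i + 1)) :
    EV R C N (i + 1) := by
  refine subsingleton_of_forall_eq 0 fun x => ?_
  obtain ⟨y, rfl⟩ := Abelian.Ext.contravariant_sequence_exact₃ h.shortExact (ModuleCat.of R N) x
    (h2.elim _ _) (Nat.add_comm 1 i)
  rw [show y = 0 from h1.elim _ _, Abelian.Ext.comp_zero]

lemma extend (h : SES f g) (h3 : EV R C N 1) (φ : A →ₗ[R] N) : ∃ ψ : B →ₗ[R] N, ψ ∘ₗ f = φ := by
  obtain ⟨y, hy⟩ := Abelian.Ext.contravariant_sequence_exact₁ h.shortExact (ModuleCat.of R N)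
    (Abelian.Ext.mk₀ (ModuleCat.ofHom φ)) (n₁ := 1) rfl (h3.elim _ _)
  obtain ⟨ψ, rfl⟩ := (Abelian.Ext.mk₀_bijective _ _).surjective y
  rw [Abelian.Ext.mk₀_comp_mk₀] at hy
  have := (Abelian.Ext.mk₀_bijective _ _).injective hy
  exact ⟨ψ.hom, by simpa using congrArg ModuleCat.Hom.hom this⟩

lemma lift (h : SES f g) (h1 : EV R M A 1) (φ : M →ₗ[R] C) : ∃ ψ : M →ₗ[R] B, g ∘ₗ ψ = φ := by
  obtain ⟨y, hy⟩ := Abelian.Ext.covariant_sequence_exact₃ (ModuleCat.of R M) h.shortExact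
    (Abelian.Ext.mk₀ (ModuleCat.ofHom φ)) (n₁ := 1) rfl (h1.elim _ _)
  obtain ⟨ψ, rfl⟩ := (Abelian.Ext.mk₀_bijective _ _).surjective y
  rw [Abelian.Ext.mk₀_comp_mk₀] at hy
  have := (Abelian.Ext.mk₀_bijective _ _).injective hy
  exact ⟨ψ.hom, by simpa using congrArg ModuleCat.Hom.hom this⟩

lemma ev_one_of_extend (h : SES f g) (h2 : EV R B N 1)
    (H : ∀ φ : A →ₗ[R] N, ∃ ψ : B →ₗ[R] N, ψ ∘ₗ f = φ) : EV R C N 1 := by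
  refine subsingleton_of_forall_eq 0 fun x => ?_
  obtain ⟨y, rfl⟩ := Abelian.Ext.contravariant_sequence_exact₃ h.shortExact (ModuleCat.of R N) x
    (h2.elim _ _) (n₀ := 0) rfl
  obtain ⟨φ, rfl⟩ := (Abelian.Ext.mk₀_bijective _ _).surjective y
  obtain ⟨ψ, hψ⟩ := H φ.hom
  have : φ = h.complex.f ≫ ModuleCat.ofHom ψ := by
    ext x; exact (LinearMap.congr_fun hψ x).symm
  rw [this, ← Abelian.Ext.mk₀_comp_mk₀]
  rw [← Abelian.Ext.comp_assoc _ _ _ (add_zero 1) (zero_add 0) rfl, h.shortExact.extClass_comp,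
    Abelian.Ext.zero_comp]

end SES

lemma ev_projective [Module.Projective R M] (i : ℕ) : EV R M N (i + 1) := by
  have : Projective (ModuleCat.of R M) :=
    (IsProjective.iff_projective M).1 inferInstance
  exact subsingleton_of_forall_eq 0 fun x => Abelian.Ext.eq_zero_of_projective x

lemma EV.congr_left (e : A ≃ₗ[R] B) {i : ℕ} (h : EV R A N i) : EV R B N i := by
  refine subsingleton_of_forall_eq 0 fun x => ?_
  have h1 : (Abelian.Ext.mk₀ (ModuleCat.ofHom e.symm.toLinearMap)).comp
      ((Abelian.Ext.mk₀ (ModuleCat.ofHom e.toLinearMap)).comp x (zero_add i)) (zero_add i) = x := by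
    rw [Abelian.Ext.mk₀_comp_mk₀_assoc]
    have : ModuleCat.ofHom e.symm.toLinearMap ≫ ModuleCat.ofHom e.toLinearMap = 𝟙 _ := by
      ext x; simp
    rw [this, Abelian.Ext.mk₀_id_comp]
  rw [← h1, show (Abelian.Ext.mk₀ (ModuleCat.ofHom e.toLinearMap)).comp x (zero_add i) = 0 from
    h.elim _ _, Abelian.Ext.comp_zero]

lemma EV.congr_right (e : A ≃ₗ[R] B) {i : ℕ} (h : EV R M A i) : EV R M B i := by
  refine subsingleton_of_forall_eq 0 fun x => ?_
  have h1 : (x.comp (Abelian.Ext.mk₀ (ModuleCat.ofHom e.symm.toLinearMap)) (add_zero i)).comp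
      (Abelian.Ext.mk₀ (ModuleCat.ofHom e.toLinearMap)) (add_zero i) = x := by
    rw [Abelian.Ext.comp_assoc_of_third_deg_zero, Abelian.Ext.mk₀_comp_mk₀]
    have : ModuleCat.ofHom e.symm.toLinearMap ≫ ModuleCat.ofHom e.toLinearMap = 𝟙 _ := by
      ext x; simp
    rw [this, Abelian.Ext.comp_mk₀_id]
  rw [← h1, show x.comp (Abelian.Ext.mk₀ (ModuleCat.ofHom e.symm.toLinearMap)) (add_zero i) = 0
    from h.elim _ _, Abelian.Ext.zero_comp]

lemma ev_zero_iff : EV R M N 0 ↔ Subsingleton (M →ₗ[R] N) :=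
  ((Abelian.Ext.linearEquiv₀ (R := R) (X := ModuleCat.of R M) (Y := ModuleCat.of R N)).trans
    ModuleCat.homLinearEquiv).toEquiv.subsingleton_congr

lemma SES.ker_of_surjective (g : B →ₗ[R] C) (hg : Function.Surjective g) :
    SES (LinearMap.ker g).subtype g :=
  ⟨Subtype.val_injective, hg, LinearMap.exact_subtype_ker_map g⟩

/-- Multiplication by a regular element. -/
lemma SES.smul (x : R) (hx : IsSMulRegular A x) :
    SES (LinearMap.lsmul R A x) (x • (⊤ : Submodule R A)).mkQ := by
  refine ⟨fun a b h => hx h, Submodule.mkQ_surjective _, ?_⟩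
  intro y
  simp [Submodule.mem_smul_pointwise_iff_exists]

end ExtSequences

section LocalBasics

variable {R : Type u} [CommRing R]
variable {A N C K : Type u} [AddCommGroup A] [Module R A] [AddCommGroup N] [Module R N]
  [AddCommGroup C] [Module R C] [AddCommGroup K] [Module R K]

lemma ev_of_quotient_smul [IsNoetherianRing R] [IsLocalRing R] [Module.Finite R A]
    [Module.Finite R N] {x : R} (hx : x ∈ IsLocalRing.maximalIdeal R) (hreg : IsSMulRegular A x)
    {i : ℕ} (h : EV R (A ⧸ (x • (⊤ : Submodule R A))) N (i + 1)) : EV R A N i := by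
  have hf : Module.Finite R (Abelian.Ext (ModuleCat.of R A) (ModuleCat.of R N) i) := by
    have : Module.Finite R (ModuleCat.of R A) := ‹Module.Finite R A›
    have : Module.Finite R (ModuleCat.of R N) := ‹Module.Finite R N›
    infer_instance
  have h1 : (⊤ : Submodule R (Abelian.Ext (ModuleCat.of R A) (ModuleCat.of R N) i)) ≤
      IsLocalRing.maximalIdeal R • ⊤ := by
    rintro z -
    obtain ⟨y, rfl⟩ := Abelian.Ext.contravariant_sequence_exact₁ (SES.smul x hreg).shortExact
      (ModuleCat.of R N) z (Nat.add_comm 1 i) (h.elim _ _)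
    have : (ModuleCat.ofHom (LinearMap.lsmul R A x)) = x • 𝟙 (ModuleCat.of R A) := by
      ext; simp
    change (Abelian.Ext.mk₀ (ModuleCat.ofHom (LinearMap.lsmul R A x))).comp y (zero_add i) ∈ _
    rw [this, Abelian.Ext.mk₀_smul, Abelian.Ext.smul_comp, Abelian.Ext.mk₀_id_comp]
    exact Submodule.smul_mem_smul hx trivial
  have h2 := Submodule.eq_bot_of_le_smul_of_le_jacobson_bot _ _ hf.fg_top h1
    (IsLocalRing.maximalIdeal_le_jacobson _)
  exact (Submodule.subsingleton_iff R).1 (subsingleton_of_bot_eq_top h2.symm)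

lemma subsingleton_of_hom_subsingleton [IsNoetherianRing R] [Module.Finite R C]
    [Module.Finite R K]
    (hC : Function.Injective (LinearMap.lsmul R C)) (h : Subsingleton (C →ₗ[R] K)) :
    Subsingleton K := by
  obtain ⟨r, hr, hreg⟩ := IsSMulRegular.subsingleton_linearMap_iff.1 h
  have : r = 0 := hC (by
    ext c
    simpa using Module.mem_annihilator.1 hr c)
  subst this
  exact ⟨fun a b => hreg (by simp)⟩

end LocalBasics

section TensorChase

variable {R : Type u} [CommRing R]
variable {A B C K' P K : Type u} [AddCommGroup A] [Module R A] [AddCommGroup B] [Module R B]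
  [AddCommGroup C] [Module R C] [AddCommGroup K'] [Module R K'] [AddCommGroup P] [Module R P]
  [AddCommGroup K] [Module R K]
  {f : A →ₗ[R] B} {g : B →ₗ[R] C} {ι : K' →ₗ[R] P} {π : P →ₗ[R] K}

lemma lTensor_rTensor_comm_apply {A B K P : Type u} [AddCommGroup A] [Module R A] [AddCommGroup B]
    [Module R B] [AddCommGroup K] [Module R K] [AddCommGroup P] [Module R P]
    (f : A →ₗ[R] B) (ι : K →ₗ[R] P) (x : TensorProduct R A K) :
    f.rTensor P (ι.lTensor A x) = ι.lTensor B (f.rTensor K x) := by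
  rw [← LinearMap.comp_apply, ← LinearMap.comp_apply, LinearMap.lTensor_comp_rTensor,
    LinearMap.rTensor_comp_lTensor]

lemma rTensor_injective_of_lTensor_injective [Module.Flat R P] (h : SES f g) (k : SES ι π)
    (hC : Function.Injective (ι.lTensor C)) : Function.Injective (f.rTensor K) := by
  rw [injective_iff_map_eq_zero]
  intro x hx
  obtain ⟨a, rfl⟩ := LinearMap.lTensor_surjective A k.surj x
  rw [lTensor_rTensor_comm_apply] at hx
  obtain ⟨b, hb⟩ := (lTensor_exact B k.exact k.surj _).1 hx
  have h1 : ι.lTensor C (g.rTensor K' b) = 0 := by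
    rw [← lTensor_rTensor_comm_apply, hb]
    exact (rTensor_exact P h.exact h.surj).apply_apply_eq_zero a
  have h2 : g.rTensor K' b = 0 := hC (by rw [h1, map_zero])
  obtain ⟨a', rfl⟩ := (rTensor_exact K' h.exact h.surj _).1 h2
  rw [← lTensor_rTensor_comm_apply] at hb
  have h3 := Module.Flat.rTensor_preserves_injective_linearMap (M := P) f h.inj hb
  rw [← h3]
  exact (lTensor_exact A k.exact k.surj).apply_apply_eq_zero a'

lemma lTensor_injective_of_rTensor_injective [Module.Flat R P] (h : SES f g) (k : SES ι π)
    (hf : Function.Injective (f.rTensor K)) (hB : Function.Injective (ι.lTensor B)) :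
    Function.Injective (ι.lTensor C) := by
  rw [injective_iff_map_eq_zero]
  intro c hc
  obtain ⟨b, rfl⟩ := LinearMap.rTensor_surjective K' h.surj c
  rw [← lTensor_rTensor_comm_apply] at hc
  obtain ⟨a, ha⟩ := (rTensor_exact P h.exact h.surj _).1 hc
  have h1 : π.lTensor A a = 0 := hf (by
    rw [lTensor_rTensor_comm_apply, ha, map_zero]
    exact (lTensor_exact B k.exact k.surj).apply_apply_eq_zero b)
  obtain ⟨a', rfl⟩ := (lTensor_exact A k.exact k.surj _).1 h1
  rw [lTensor_rTensor_comm_apply] at ha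
  rw [← hB ha]
  exact (rTensor_exact K' h.exact h.surj).apply_apply_eq_zero a'

lemma rTensor_injective_of_flat [Module.Flat R P] (hf : Function.Injective f)
    (hA : Function.Injective (ι.lTensor A)) : Function.Injective (f.rTensor K') := by
  have := (Module.Flat.rTensor_preserves_injective_linearMap (M := P) f hf).comp hA
  intro x y hxy
  refine this ?_
  simp only [Function.comp_apply, lTensor_rTensor_comm_apply, hxy]

/-- A projective resolution of `ω`, cut into short exact sequences. -/
structure Syz (R : Type u) [CommRing R] (ω : Type u) [AddCommGroup ω] [Module R ω] where
  K : ℕ → ModuleCat.{u} R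
  P : ℕ → ModuleCat.{u} R
  ι : ∀ i, K (i + 1) →ₗ[R] P i
  π : ∀ i, P i →ₗ[R] K i
  ses : ∀ i, SES (ι i) (π i)
  proj : ∀ i, Module.Projective R (P i)
  iso : K 0 ≃ₗ[R] ω

attribute [instance] Syz.proj

variable {ω : Type u} [AddCommGroup ω] [Module R ω]

/-- Vanishing of `Tor_{i+1}(M, ω)`. -/
def TV (s : Syz R ω) (M : Type u) [AddCommGroup M] [Module R M] (i : ℕ) : Prop :=
  Function.Injective ((s.ι i).lTensor M)

variable (s : Syz R ω)

lemma rTensor_injective_K {i : ℕ} (h : SES f g) (hC : TV s C i) :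
    Function.Injective (f.rTensor (s.K i)) :=
  rTensor_injective_of_lTensor_injective h (s.ses i) hC

lemma injective_of_square {A B A' B' : Type u} [AddCommGroup A] [Module R A] [AddCommGroup B]
    [Module R B] [AddCommGroup A'] [Module R A'] [AddCommGroup B'] [Module R B']
    (e : A ≃ₗ[R] A') (e' : B ≃ₗ[R] B') (u : A →ₗ[R] B) (v : A' →ₗ[R] B')
    (h : v ∘ₗ e.toLinearMap = e'.toLinearMap ∘ₗ u) (hu : Function.Injective u) :
    Function.Injective v := by
  have : v = e'.toLinearMap ∘ₗ u ∘ₗ e.symm.toLinearMap := by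
    rw [← LinearMap.comp_assoc, ← h]; ext; simp
  rw [this]
  exact e'.injective.comp (hu.comp e.symm.injective)

lemma rTensor_injective_of_iso {K₁ K₂ : Type u} [AddCommGroup K₁] [Module R K₁]
    [AddCommGroup K₂] [Module R K₂] (e : K₁ ≃ₗ[R] K₂) (h : Function.Injective (f.rTensor K₁)) :
    Function.Injective (f.rTensor K₂) :=
  injective_of_square (e.lTensor A) (e.lTensor B) (f.rTensor K₁) _ (by ext; simp) h

lemma TV.rTensor_injective (h : SES f g) (hC : TV s C 0) : Function.Injective (f.rTensor ω) :=
  rTensor_injective_of_iso s.iso (rTensor_injective_K s h hC)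

lemma TV.of_rTensor_injective (h : SES f g) (hB : TV s B 0)
    (hf : Function.Injective (f.rTensor ω)) : TV s C 0 :=
  lTensor_injective_of_rTensor_injective h (s.ses 0)
    (rTensor_injective_of_iso s.iso.symm hf) hB

lemma TV.right (h : SES f g) {i : ℕ} (hB : TV s B (i + 1)) (hA : TV s A i) : TV s C (i + 1) :=
  lTensor_injective_of_rTensor_injective h (s.ses (i + 1))
    (rTensor_injective_of_flat h.inj hA) hB

lemma TV.of_flat [Module.Flat R A] (i : ℕ) : TV s A i :=
  Module.Flat.lTensor_preserves_injective_linearMap _ (s.ses i).inj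

variable {s} in
lemma TV.congr (e : A ≃ₗ[R] B) {i : ℕ} (h : TV s A i) : TV s B i :=
  injective_of_square (e.rTensor _) (e.rTensor _) ((s.ι i).lTensor A) _ (by ext; simp) h

end TensorChase

section TorComparison

variable {R : Type u} [CommRing R] {ω : Type u} [AddCommGroup ω] [Module R ω]

/-- The underlying modules of the syzygies in a projective resolution. -/
def syzK (P : ProjectiveResolution (ModuleCat.of R ω)) : ℕ → ModuleCat.{u} R
  | 0 => ModuleCat.of R ω
  | i + 1 => ModuleCat.of R (LinearMap.range (P.complex.d (i + 1) i).hom)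

def syzπ (P : ProjectiveResolution (ModuleCat.of R ω)) : ∀ i, P.complex.X i →ₗ[R] syzK P i
  | 0 => (P.π.f 0).hom
  | i + 1 => (P.complex.d (i + 1) i).hom.rangeRestrict

lemma range_d_eq_ker (P : ProjectiveResolution (ModuleCat.of R ω)) (i : ℕ) :
    LinearMap.range (P.complex.d (i + 1) i).hom = LinearMap.ker (syzπ P i) := by
  rcases i with _ | i
  · exact P.exact₀.moduleCat_range_eq_ker
  · change _ = LinearMap.ker (P.complex.d (i + 1) i).hom.rangeRestrict
    rw [LinearMap.ker_rangeRestrict]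
    exact (P.exact_succ i).moduleCat_range_eq_ker

/-- The syzygies of a projective resolution. -/
def syzOf (P : ProjectiveResolution (ModuleCat.of R ω)) : Syz R ω where
  K := syzK P
  P := P.complex.X
  ι i := (LinearMap.range (P.complex.d (i + 1) i).hom).subtype
  π := syzπ P
  ses i := by
    refine ⟨Subtype.val_injective, ?_, ?_⟩
    · rcases i with _ | i
      · exact (ModuleCat.epi_iff_surjective (P.π.f 0)).1 inferInstance
      · exact LinearMap.surjective_rangeRestrict _
    · intro y
      rw [← LinearMap.mem_ker, ← range_d_eq_ker]
      exact ⟨fun h => ⟨⟨y, h⟩, rfl⟩, fun ⟨x, hx⟩ => hx ▸ x.2⟩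
  proj i := (IsProjective.iff_projective _).2 (P.projective i)
  iso := LinearEquiv.refl R ω

lemma subsingleton_torGrp_iff (P : ProjectiveResolution (ModuleCat.of R ω)) (M : Type u)
    [AddCommGroup M] [Module R M] (i : ℕ) :
    Subsingleton (TorGrp R M ω (i + 1)) ↔ TV (syzOf P) M i := by
  have e := P.isoLeftDerivedObj ((MonoidalCategory.tensoringLeft (ModuleCat.{u} R)).obj
    (ModuleCat.of R M)) (i + 1)
  rw [← ModuleCat.isZero_iff_subsingleton]
  change Limits.IsZero ((Functor.leftDerived ((MonoidalCategory.tensoringLeft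
    (ModuleCat.{u} R)).obj (ModuleCat.of R M)) (i + 1)).obj (ModuleCat.of R ω)) ↔ _
  rw [e.isZero_iff]
  change Limits.IsZero (HomologicalComplex.homology _ _) ↔ _
  rw [← HomologicalComplex.exactAt_iff_isZero_homology,
    HomologicalComplex.exactAt_iff' _ (i + 2) (i + 1) i (by simp) (by simp),
    ShortComplex.ShortExact.moduleCat_exact_iff_function_exact]
  change Function.Exact (((syzOf P).ι (i + 1) ∘ₗ (syzOf P).π (i + 2)).lTensor M)
    (((syzOf P).ι i ∘ₗ (syzOf P).π (i + 1)).lTensor M) ↔ _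
  have k := lTensor_exact M ((syzOf P).ses (i + 1)).exact ((syzOf P).ses (i + 1)).surj
  have l1 := LinearMap.lTensor_surjective M ((syzOf P).ses (i + 1)).surj
  have l2 := LinearMap.lTensor_surjective M ((syzOf P).ses (i + 2)).surj
  rw [LinearMap.lTensor_comp, LinearMap.lTensor_comp]
  constructor
  · intro H
    refine (injective_iff_map_eq_zero _).2 fun x hx => ?_
    obtain ⟨y, rfl⟩ := l1 x
    obtain ⟨z, rfl⟩ := (H y).1 hx
    exact k.apply_apply_eq_zero _
  · intro H y
    constructor
    · intro hy
      have := H (a₂ := 0) (by simpa using hy)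
      obtain ⟨z, hz⟩ := (k y).1 this
      obtain ⟨w, rfl⟩ := l2 z
      exact ⟨w, hz⟩
    · rintro ⟨w, rfl⟩
      simp only [LinearMap.comp_apply]
      rw [k.apply_apply_eq_zero, map_zero]

/-- A chosen sequence of syzygies. -/
def stdSyz (R : Type u) [CommRing R] (ω : Type u) [AddCommGroup ω] [Module R ω] : Syz R ω :=
  syzOf (projectiveResolution (ModuleCat.of R ω))

end TorComparison

section FreeAuslander

variable {R : Type u} [CommRing R]
variable {A B C M N : Type u} [AddCommGroup A] [Module R A] [AddCommGroup B] [Module R B]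
  [AddCommGroup C] [Module R C] [AddCommGroup M] [Module R M] [AddCommGroup N] [Module R N]

lemma SES.ev_one_of_lift {f : A →ₗ[R] B} {g : B →ₗ[R] C} (h : SES f g) (h2 : EV R M B 1)
    (H : ∀ φ : M →ₗ[R] C, ∃ ψ : M →ₗ[R] B, g ∘ₗ ψ = φ) : EV R M A 1 := by
  refine subsingleton_of_forall_eq 0 fun x => ?_
  obtain ⟨y, rfl⟩ := Abelian.Ext.covariant_sequence_exact₁ (ModuleCat.of R M) h.shortExact x
    (h2.elim _ _) (n₀ := 0) rfl
  obtain ⟨φ, rfl⟩ := (Abelian.Ext.mk₀_bijective _ _).surjective y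
  obtain ⟨ψ, hψ⟩ := H φ.hom
  have : φ = ModuleCat.ofHom ψ ≫ h.complex.g := by
    ext x; exact (LinearMap.congr_fun hψ x).symm
  rw [this, ← Abelian.Ext.mk₀_comp_mk₀]
  rw [Abelian.Ext.comp_assoc _ _ _ (zero_add 0) (zero_add 1) rfl, h.shortExact.comp_extClass,
    Abelian.Ext.comp_zero]

lemma SES.prod : SES (LinearMap.inl R A B) (LinearMap.snd R A B) :=
  ⟨LinearMap.inl_injective, LinearMap.snd_surjective, by
    rintro ⟨x, y⟩
    simp [eq_comm]⟩

lemma ev_of_subsingleton [Subsingleton N] (i : ℕ) : EV R M N i := by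
  refine subsingleton_of_forall_eq 0 fun x => ?_
  have h1 := Abelian.Ext.comp_mk₀_id x
  have : 𝟙 (ModuleCat.of R N) = 0 := by
    ext y; exact Subsingleton.elim (α := N) _ _
  rw [this, Abelian.Ext.mk₀_zero, Abelian.Ext.comp_zero] at h1
  exact h1.symm

lemma ev_of_subsingleton_left [Subsingleton M] (i : ℕ) : EV R M N i := by
  refine subsingleton_of_forall_eq 0 fun x => ?_
  have h1 := Abelian.Ext.mk₀_id_comp x
  have : 𝟙 (ModuleCat.of R M) = 0 := by
    ext y; exact Subsingleton.elim (α := M) _ _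
  rw [this, Abelian.Ext.mk₀_zero, Abelian.Ext.zero_comp] at h1
  exact h1.symm

lemma EV.pi {i : ℕ} (h : EV R M N i) (n : ℕ) : EV R M (Fin n → N) i := by
  induction n with
  | zero => exact ev_of_subsingleton i
  | succ n ih => exact (SES.prod.cov₂ h ih).congr_right (Fin.consLinearEquiv R (fun _ => N))

/-- The Auslander class, phrased with the auxiliary vanishing predicates. -/
structure Aus {ω : Type u} [AddCommGroup ω] [Module R ω] (s : Syz R ω) (M : Type u)
    [AddCommGroup M] [Module R M] : Prop where
  bij : Function.Bijective (TensorProduct.mk R M ω)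
  tv : ∀ i, TV s M i
  ev : ∀ i, EV R ω (M ⊗[R] ω) (i + 1)

variable {ω : Type u} [AddCommGroup ω] [Module R ω] (s : Syz R ω)

/-- A semidualizing module, phrased with the auxiliary vanishing predicates. -/
structure Semi (R : Type u) [CommRing R] (ω : Type u) [AddCommGroup ω] [Module R ω] : Prop where
  fin : Module.Finite R ω
  bij : Function.Bijective (LinearMap.lsmul R ω)
  ev : ∀ i, EV R ω ω (i + 1)

lemma mk_naturality (f : A →ₗ[R] B) (a : A) :
    TensorProduct.mk R B ω (f a) = f.rTensor ω ∘ₗ TensorProduct.mk R A ω a := by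
  ext; rfl

lemma mk_bijective_of_iso (e : A ≃ₗ[R] B) (h : Function.Bijective (TensorProduct.mk R A ω)) :
    Function.Bijective (TensorProduct.mk R B ω) := by
  have : TensorProduct.mk R B ω = (LinearEquiv.congrRight (e.rTensor ω)).toLinearMap ∘ₗ
      TensorProduct.mk R A ω ∘ₗ e.symm.toLinearMap := by
    ext b w
    change _ = e.rTensor ω (e.symm b ⊗ₜ w)
    simp
  rw [this]
  exact ((e.rTensor ω).congrRight (R := R) (M := ω)).bijective.comp (h.comp e.symm.bijective)

lemma mk_bijective_pi (hω : Function.Bijective (LinearMap.lsmul R ω)) (n : ℕ) :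
    Function.Bijective (TensorProduct.mk R (Fin n → R) ω) := by
  let e : (Fin n → R) ⊗[R] ω ≃ₗ[R] (Fin n → ω) :=
    (TensorProduct.comm R _ _).trans (TensorProduct.piScalarRight R R ω (Fin n))
  have he : ∀ (x : Fin n → R) (w : ω) (j : Fin n), e (x ⊗ₜ w) j = x j • w := by
    intro x w j
    simp [e]
  constructor
  · intro x y hxy
    ext j
    refine hω.1 (LinearMap.ext fun w => ?_)
    have := congrArg (fun φ => e (φ w) j) hxy
    simpa [he] using this
  · intro φ
    choose x hx using fun j => hω.2 (LinearMap.proj j ∘ₗ e.toLinearMap ∘ₗ φ)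
    refine ⟨x, LinearMap.ext fun w => e.injective (funext fun j => ?_)⟩
    have := LinearMap.congr_fun (hx j) w
    simpa [he] using this

variable {s} in
lemma Aus.congr (e : A ≃ₗ[R] B) (h : Aus s A) : Aus s B where
  bij := mk_bijective_of_iso e h.bij
  tv i := (h.tv i).congr e
  ev i := (h.ev i).congr_right (e.rTensor ω)

lemma Semi.aus_free [Nontrivial R] (hω : Semi R ω) (F : Type u) [AddCommGroup F] [Module R F]
    [Module.Free R F]
    [Module.Finite R F] : Aus s F := by
  have : Aus s (Fin (Module.finrank R F) → R) := by
    refine ⟨mk_bijective_pi hω.bij _, fun i => TV.of_flat s i, fun i => ?_⟩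
    exact ((hω.ev i).pi _).congr_right
      ((TensorProduct.comm R _ _).trans (TensorProduct.piScalarRight R R ω _)).symm
  exact this.congr (Module.finBasis R F).equivFun.symm

/-- In a short exact sequence, the Auslander class passes to the cokernel. -/
lemma Aus.right {f : A →ₗ[R] B} {g : B →ₗ[R] C} (h : SES f g) (hA : Aus s A) (hB : Aus s B)
    (hf : Function.Injective (f.rTensor ω)) : Aus s C := by
  have k : SES (f.rTensor ω) (g.rTensor ω) :=
    ⟨hf, LinearMap.rTensor_surjective _ h.surj, rTensor_exact ω h.exact h.surj⟩
  refine ⟨⟨?_, ?_⟩, ?_, ?_⟩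
  · rw [injective_iff_map_eq_zero]
    intro c hc
    obtain ⟨b, rfl⟩ := h.surj c
    rw [mk_naturality] at hc
    have h1 : ∀ w, ∃ t, f.rTensor ω t = b ⊗ₜ w := fun w => (k.exact _).1 (LinearMap.congr_fun hc w)
    let φ : ω →ₗ[R] A ⊗[R] ω := (LinearEquiv.ofInjective _ hf).symm.toLinearMap ∘ₗ
      (TensorProduct.mk R B ω b).codRestrict (LinearMap.range (f.rTensor ω)) h1
    have hφ : f.rTensor ω ∘ₗ φ = TensorProduct.mk R B ω b := by
      ext w
      have := LinearEquiv.apply_symm_apply (LinearEquiv.ofInjective _ hf)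
        ((TensorProduct.mk R B ω b).codRestrict (LinearMap.range (f.rTensor ω)) h1 w)
      exact congrArg Subtype.val this
    obtain ⟨a, ha⟩ := hA.bij.2 φ
    rw [← ha, ← mk_naturality] at hφ
    rw [← hB.bij.1 hφ]
    exact h.exact.apply_apply_eq_zero a
  · intro φ
    obtain ⟨ψ, rfl⟩ := k.lift (hA.ev 0) φ
    obtain ⟨b, rfl⟩ := hB.bij.2 ψ
    exact ⟨g b, mk_naturality _ _⟩
  · rintro (_ | i)
    · exact TV.of_rTensor_injective s h (hB.tv 0) hf
    · exact TV.right s h (hB.tv (i + 1)) (hA.tv i)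
  · intro i
    exact k.cov₃ (hB.ev i) (hA.ev (i + 1))

lemma Aus.rTensor_injective [IsNoetherianRing R] [Module.Finite R A] (hω : Semi R ω)
    {f : A →ₗ[R] B} (hf : Function.Injective f) (hA : Aus s A) (hB : Aus s B) :
    Function.Injective (f.rTensor ω) := by
  have := hω.fin
  have h1 : Subsingleton (ω →ₗ[R] LinearMap.ker (f.rTensor ω)) := by
    refine subsingleton_of_forall_eq 0 fun φ => ?_
    obtain ⟨a, ha⟩ := hA.bij.2 ((LinearMap.ker (f.rTensor ω)).subtype ∘ₗ φ)
    have h2 : TensorProduct.mk R B ω (f a) = 0 := by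
      rw [mk_naturality, ha]
      ext w
      exact (φ w).2
    have h3 : a = 0 := hf (hB.bij.1 (by rw [h2, map_zero, map_zero]))
    rw [h3, map_zero] at ha
    ext w
    exact (LinearMap.congr_fun ha w).symm
  have h2 := subsingleton_of_hom_subsingleton hω.bij.1 h1
  rw [← LinearMap.ker_eq_bot]
  exact (Submodule.subsingleton_iff_eq_bot).1 h2

end FreeAuslander

section TotallyReflexive

variable {R : Type u} [CommRing R]

/-- Totally reflexive modules. -/
structure TR (R : Type u) [CommRing R] (X : Type u) [AddCommGroup X] [Module R X] : Prop where
  fin : Module.Finite R X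
  bij : Function.Bijective (Module.Dual.eval R X)
  ev : ∀ i, EV R X R (i + 1)
  ev' : ∀ i, EV R (X →ₗ[R] R) R (i + 1)

variable {X Y F Z : Type u} [AddCommGroup X] [Module R X] [AddCommGroup Y] [Module R Y]
  [AddCommGroup F] [Module R F] [AddCommGroup Z] [Module R Z]

lemma TR.dual [IsNoetherianRing R] (h : TR R X) : TR R (X →ₗ[R] R) where
  fin := have := h.fin; inferInstance
  bij := by
    let e := LinearEquiv.ofBijective _ h.bij
    have h1 : e.dualMap ∘ₗ Module.Dual.eval R (Module.Dual R X) = LinearMap.id := by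
      ext φ x; rfl
    have h2 : Module.Dual.eval R (Module.Dual R X) = e.dualMap.symm.toLinearMap := by
      ext φ x
      have := LinearMap.congr_fun h1 φ
      rw [LinearMap.comp_apply] at this
      have h3 := e.dualMap.injective (this.trans (e.dualMap.apply_symm_apply φ).symm)
      exact LinearMap.congr_fun h3 x
    change Function.Bijective (Module.Dual.eval R (Module.Dual R X))
    rw [h2]
    exact e.dualMap.symm.bijective
  ev := h.ev'
  ev' i := (h.ev i).congr_left (LinearEquiv.ofBijective _ h.bij)

lemma SES.dual {f : Z →ₗ[R] F} {g : F →ₗ[R] X} (h : SES f g) (hX : EV R X Y 1) :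
    SES (LinearMap.lcomp R Y g) (LinearMap.lcomp R Y f) := by
  refine ⟨fun φ ψ hφ => ?_, fun φ => h.extend hX φ, fun φ => ⟨fun hφ => ?_, ?_⟩⟩
  · ext x
    obtain ⟨y, rfl⟩ := h.surj x
    exact LinearMap.congr_fun hφ y
  · have h1 : LinearMap.ker g ≤ LinearMap.ker φ := by
      intro y hy
      obtain ⟨z, rfl⟩ := (h.exact y).1 hy
      exact LinearMap.congr_fun hφ z
    let e := g.quotKerEquivOfSurjective h.surj
    refine ⟨(LinearMap.ker g).liftQ φ h1 ∘ₗ e.symm.toLinearMap, ?_⟩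
    ext y
    have : e.symm (g y) = (LinearMap.ker g).mkQ y := by
      rw [LinearEquiv.symm_apply_eq]; rfl
    simp [this]
  · rintro ⟨ψ, rfl⟩
    ext z
    simp [h.exact.apply_apply_eq_zero]

lemma TR.left [IsNoetherianRing R] {f : Z →ₗ[R] F} {g : F →ₗ[R] X} (h : SES f g)
    [Module.Free R F] [Module.Finite R F] (hX : TR R X) : TR R Z := by
  have k := h.dual (hX.ev 0)
  have hz : Function.Bijective (Module.Dual.eval R Z) := by
    constructor
    · intro a b hab
      refine h.inj ((Module.bijective_dual_eval R F).1 ?_)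
      ext φ
      exact LinearMap.congr_fun hab (φ ∘ₗ f)
    · intro ψ
      obtain ⟨y, hy⟩ := (Module.bijective_dual_eval R F).2 (ψ ∘ₗ LinearMap.lcomp R R f)
      have h1 : g y = 0 := hX.bij.1 (by
        ext φ
        have := LinearMap.congr_fun hy (φ ∘ₗ g)
        have h2 : LinearMap.lcomp R R f (φ ∘ₗ g) = 0 := by
          ext z; simp [h.exact.apply_apply_eq_zero]
        rw [LinearMap.comp_apply, h2, map_zero] at this
        simpa using this)
      obtain ⟨z, rfl⟩ := (h.exact y).1 h1
      refine ⟨z, ?_⟩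
      ext φ
      obtain ⟨φ', rfl⟩ := k.surj φ
      exact LinearMap.congr_fun hy φ'
  refine ⟨Module.Finite.of_injective f h.inj, hz, fun i => h.con₁ (ev_projective i) (hX.ev (i + 1)),
    ?_⟩
  rintro (_ | i)
  · refine k.ev_one_of_extend (ev_projective 0) fun ψ => ?_
    obtain ⟨x, rfl⟩ := hX.bij.2 ψ
    obtain ⟨y, rfl⟩ := h.surj x
    exact ⟨Module.Dual.eval R F y, by ext φ; rfl⟩
  · exact k.con₃ (hX.ev' i) (ev_projective (i + 1))

/-- A finitely generated module is a quotient of a finite free one. -/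
lemma exists_free_cover (R X : Type u) [CommRing R] [AddCommGroup X] [Module R X]
    [Module.Finite R X] : ∃ (n : ℕ) (g : (Fin n → R) →ₗ[R] X), Function.Surjective g :=
  Module.Finite.exists_fin' R X

lemma TR.exists_cosyzygy [IsNoetherianRing R] (hX : TR R X) :
    ∃ (n : ℕ) (X' : ModuleCat.{u} R) (f : X →ₗ[R] ((Fin n → R) →ₗ[R] R))
      (g : ((Fin n → R) →ₗ[R] R) →ₗ[R] X'), SES f g ∧ TR R X' := by
  have := hX.dual.fin
  obtain ⟨n, p, hp⟩ := exists_free_cover R (X →ₗ[R] R)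
  have h := SES.ker_of_surjective p hp
  have hK := TR.left h hX.dual
  have k := h.dual (hX.dual.ev 0)
  refine ⟨n, ModuleCat.of R (LinearMap.ker p →ₗ[R] R), LinearMap.lcomp R R p ∘ₗ
    Module.Dual.eval R X, LinearMap.lcomp R R (LinearMap.ker p).subtype, ⟨k.inj.comp hX.bij.1,
      k.surj, fun y => ?_⟩, hK.dual⟩
  rw [k.exact y]
  constructor
  · rintro ⟨ψ, rfl⟩
    obtain ⟨x, rfl⟩ := hX.bij.2 ψ
    exact ⟨x, rfl⟩
  · rintro ⟨x, rfl⟩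
    exact ⟨_, rfl⟩

lemma TR.ev_of_finite_injDim [IsNoetherianRing R] {ω : Type u} [AddCommGroup ω] [Module R ω]
    {n : ℕ} (hn : ∀ (M : ModuleCat.{u} R) (i : ℕ), n < i → EV R M ω i) :
    ∀ (k i : ℕ) {X : Type u} [AddCommGroup X] [Module R X], TR R X → n < i + 1 + k →
      EV R X ω (i + 1) := by
  intro k
  induction k with
  | zero => exact fun i X _ _ _ hi => hn (ModuleCat.of R X) (i + 1) hi
  | succ k ih =>
    intro i X _ _ hX hi
    obtain ⟨m, X', f, g, h, hX'⟩ := hX.exists_cosyzygy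
    exact h.con₁ (ev_projective i) (ih (i + 1) hX' (by omega))

variable {ω : Type u} [AddCommGroup ω] [Module R ω] (s : Syz R ω)

lemma dualTensorHom_naturality {A B : Type u} [AddCommGroup A] [Module R A] [AddCommGroup B]
    [Module R B] (f : A →ₗ[R] B) (t : (B →ₗ[R] R) ⊗[R] ω) :
    dualTensorHom R A ω ((LinearMap.lcomp R R f).rTensor ω t) = dualTensorHom R B ω t ∘ₗ f := by
  induction t with
  | zero => simp
  | add x y hx hy => simp only [map_add, hx, hy, LinearMap.add_comp]
  | tmul φ w => ext a; simp

lemma dualTensorHom_bijective_free [Nontrivial R] [Module.Free R F] [Module.Finite R F] :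
    Function.Bijective (dualTensorHom R F ω) := by
  have := (dualTensorHomEquivOfBasis (N := ω) (Module.finBasis R F)).bijective
  rwa [← LinearEquiv.coe_coe, dualTensorHomEquivOfBasis_toLinearMap] at this

lemma TR.dualTensorHom_surjective [Nontrivial R] [IsNoetherianRing R]
    (hev : ∀ {X : Type u} [AddCommGroup X] [Module R X], TR R X → EV R X ω 1) (hX : TR R X) :
    Function.Surjective (dualTensorHom R X ω) := by
  obtain ⟨m, X', f, g, h, hX'⟩ := hX.exists_cosyzygy
  intro φ
  obtain ⟨ψ, rfl⟩ := h.extend (hev hX') φ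
  obtain ⟨t, rfl⟩ := dualTensorHom_bijective_free.2 ψ
  exact ⟨_, dualTensorHom_naturality f t⟩

lemma TR.dualTensorHom_bijective [Nontrivial R] [IsNoetherianRing R]
    (hev : ∀ {X : Type u} [AddCommGroup X] [Module R X], TR R X → EV R X ω 1) (hX : TR R X) :
    Function.Bijective (dualTensorHom R X ω) := by
  refine ⟨?_, hX.dualTensorHom_surjective hev⟩
  obtain ⟨m, X', f, g, h, hX'⟩ := hX.exists_cosyzygy
  rw [injective_iff_map_eq_zero]
  intro t ht
  have k := h.dual (hX'.ev 0)
  obtain ⟨p, rfl⟩ := LinearMap.rTensor_surjective ω k.surj t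
  rw [dualTensorHom_naturality] at ht
  obtain ⟨ψ, hψ⟩ := ((h.dual (hev hX')).exact _).1 ht
  obtain ⟨q, rfl⟩ := hX'.dualTensorHom_surjective hev ψ
  have : p = (LinearMap.lcomp R R g).rTensor ω q := by
    apply dualTensorHom_bijective_free.1
    rw [dualTensorHom_naturality]; exact hψ.symm
  rw [this]
  exact (rTensor_exact ω k.exact k.surj).apply_apply_eq_zero q

end TotallyReflexive

section TotallyReflexiveAuslander

variable {R : Type u} [CommRing R] {A B X F Z : Type u} [AddCommGroup A] [Module R A]
  [AddCommGroup B] [Module R B] [AddCommGroup X] [Module R X] [AddCommGroup F] [Module R F]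
  [AddCommGroup Z] [Module R Z] {ω : Type u} [AddCommGroup ω] [Module R ω] (s : Syz R ω)

lemma SES.rTensor {f : A →ₗ[R] F} {g : F →ₗ[R] B} (h : SES f g)
    (hf : Function.Injective (f.rTensor ω)) : SES (f.rTensor ω) (g.rTensor ω) :=
  ⟨hf, LinearMap.rTensor_surjective _ h.surj, rTensor_exact ω h.exact h.surj⟩

/-- The natural map `X ⊗ ω → Hom(X^*, ω)`. -/
def tensorDualHom (R X ω : Type u) [CommRing R] [AddCommGroup X] [Module R X] [AddCommGroup ω]
    [Module R ω] : X ⊗[R] ω →ₗ[R] (X →ₗ[R] R) →ₗ[R] ω :=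
  dualTensorHom R (X →ₗ[R] R) ω ∘ₗ (Module.Dual.eval R X).rTensor ω

lemma tensorDualHom_naturality (f : A →ₗ[R] B) (t : A ⊗[R] ω) :
    tensorDualHom R B ω (f.rTensor ω t) = tensorDualHom R A ω t ∘ₗ LinearMap.lcomp R R f := by
  induction t with
  | zero => simp
  | add x y hx hy => simp only [map_add, hx, hy, LinearMap.add_comp]
  | tmul a w => ext φ; simp [tensorDualHom]

lemma TR.tensorDualHom_bijective [Nontrivial R] [IsNoetherianRing R]
    (hev : ∀ {X : Type u} [AddCommGroup X] [Module R X], TR R X → EV R X ω 1) (hX : TR R X) :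
    Function.Bijective (tensorDualHom R X ω) :=
  (hX.dual.dualTensorHom_bijective hev).comp
    ((LinearEquiv.ofBijective _ hX.bij).rTensor ω).bijective

lemma TR.rTensor_injective_of_syzygy [Nontrivial R] [IsNoetherianRing R]
    (hev : ∀ {X : Type u} [AddCommGroup X] [Module R X], TR R X → EV R X ω 1)
    {f : Z →ₗ[R] F} {g : F →ₗ[R] X} (h : SES f g) [Module.Free R F] [Module.Finite R F]
    (hX : TR R X) : Function.Injective (f.rTensor ω) := by
  intro x y hxy
  refine ((TR.left h hX).tensorDualHom_bijective hev).1 ?_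
  have := congrArg (tensorDualHom R F ω) hxy
  rw [tensorDualHom_naturality, tensorDualHom_naturality] at this
  ext φ
  obtain ⟨ψ, rfl⟩ := (h.dual (hX.ev 0)).surj φ
  exact LinearMap.congr_fun this ψ

lemma TR.tv [Nontrivial R] [IsNoetherianRing R]
    (hev : ∀ {X : Type u} [AddCommGroup X] [Module R X], TR R X → EV R X ω 1) (i : ℕ) :
    ∀ {X : Type u} [AddCommGroup X] [Module R X], TR R X → TV s X i := by
  induction i with
  | zero =>
    intro X _ _ hX
    have := hX.fin
    obtain ⟨n, p, hp⟩ := exists_free_cover R X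
    have h := SES.ker_of_surjective p hp
    exact TV.of_rTensor_injective s h (TV.of_flat s 0) (hX.rTensor_injective_of_syzygy hev h)
  | succ i ih =>
    intro X _ _ hX
    have := hX.fin
    obtain ⟨n, p, hp⟩ := exists_free_cover R X
    have h := SES.ker_of_surjective p hp
    exact TV.right s h (TV.of_flat s _) (ih (TR.left h hX))

lemma TR.mk_injective [Nontrivial R] [IsNoetherianRing R] (hω : Semi R ω) (hX : TR R X) :
    Function.Injective (TensorProduct.mk R X ω) := by
  obtain ⟨n, X', f, g, h, hX'⟩ := hX.exists_cosyzygy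
  rw [injective_iff_map_eq_zero]
  intro x hx
  have h2 : TensorProduct.mk R _ ω (f x) = 0 := by
    rw [mk_naturality, hx, LinearMap.comp_zero]
  exact h.inj ((hω.aus_free (stdSyz R ω) _).bij.1 (by rw [h2, map_zero, map_zero]))

lemma TR.aus [Nontrivial R] [IsNoetherianRing R] (hω : Semi R ω)
    (hev : ∀ {X : Type u} [AddCommGroup X] [Module R X], TR R X → EV R X ω 1) (i : ℕ) :
    ∀ {X : Type u} [AddCommGroup X] [Module R X], TR R X →
      Function.Surjective (TensorProduct.mk R X ω) ∧ EV R ω (X ⊗[R] ω) (i + 1) := by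
  have hsurj : ∀ {X : Type u} [AddCommGroup X] [Module R X], TR R X →
      Function.Surjective (TensorProduct.mk R X ω) := by
    intro X _ _ hX φ
    obtain ⟨n, X', f, g, h, hX'⟩ := hX.exists_cosyzygy
    have hinj := (TR.tv (stdSyz R ω) hev 0 hX').rTensor_injective _ h
    obtain ⟨y, hy⟩ := (hω.aus_free (stdSyz R ω) ((Fin n → R) →ₗ[R] R)).bij.2 (f.rTensor ω ∘ₗ φ)
    have h2 : g y = 0 := by
      apply hX'.mk_injective hω
      rw [mk_naturality, hy, map_zero]
      ext w
      exact (rTensor_exact ω h.exact h.surj).apply_apply_eq_zero _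
    obtain ⟨x, rfl⟩ := (h.exact y).1 h2
    refine ⟨x, ?_⟩
    rw [mk_naturality] at hy
    ext w
    exact hinj (LinearMap.congr_fun hy w)
  suffices H : ∀ {X : Type u} [AddCommGroup X] [Module R X], TR R X →
      EV R ω (X ⊗[R] ω) (i + 1) from fun {X} _ _ hX => ⟨hsurj hX, H hX⟩
  induction i with
  | zero =>
    intro X _ _ hX
    obtain ⟨n, X', f, g, h, hX'⟩ := hX.exists_cosyzygy
    have hinj := (TR.tv (stdSyz R ω) hev 0 hX').rTensor_injective _ h
    have k := h.rTensor hinj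
    refine k.ev_one_of_lift ((hω.aus_free (stdSyz R ω) ((Fin n → R) →ₗ[R] R)).ev 0) fun φ => ?_
    obtain ⟨x', rfl⟩ := hsurj hX' φ
    obtain ⟨y, rfl⟩ := h.surj x'
    exact ⟨TensorProduct.mk R _ ω y, (mk_naturality g y).symm⟩
  | succ i ih =>
    intro X _ _ hX
    obtain ⟨n, X', f, g, h, hX'⟩ := hX.exists_cosyzygy
    have hinj := (TR.tv (stdSyz R ω) hev 0 hX').rTensor_injective _ h
    have k := h.rTensor hinj
    exact k.cov₁ (ih hX') ((hω.aus_free (stdSyz R ω) ((Fin n → R) →ₗ[R] R)).ev (i + 1))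

lemma TR.toAus [Nontrivial R] [IsNoetherianRing R] (hω : Semi R ω)
    (hev : ∀ {X : Type u} [AddCommGroup X] [Module R X], TR R X → EV R X ω 1) (hX : TR R X) :
    Aus s X :=
  ⟨⟨hX.mk_injective hω, (TR.aus hω hev 0 hX).1⟩, fun i => TR.tv s hev i hX,
    fun i => (TR.aus hω hev i hX).2⟩

lemma _root_.Paper.GCdimZero.toTR (h : GCdimZero R R X) : TR R X where
  fin := h.1
  bij := h.2.1
  ev i := (subsingleton_extGrp_iff _ _ _).1 (h.2.2.1 (i + 1) i.succ_pos)
  ev' i := (subsingleton_extGrp_iff _ _ _).1 (h.2.2.2 (i + 1) i.succ_pos)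

lemma _root_.Paper.IsSemidualizing.toSemi (h : IsSemidualizing R ω) : Semi R ω where
  fin := h.1
  bij := h.2.1
  ev i := (subsingleton_extGrp_iff _ _ _).1 (h.2.2 (i + 1) i.succ_pos)

lemma _root_.Paper.HasFiniteInjDim.exists_ev (h : HasFiniteInjDim R ω) :
    ∃ n : ℕ, ∀ (M : ModuleCat.{u} R) (i : ℕ), n < i → EV R M ω i := by
  obtain ⟨n, hn⟩ := h
  exact ⟨n, fun M i hi => (subsingleton_extGrp_iff _ _ _).1 (hn M i hi)⟩

/-- Modules of finite G-dimension lie in the Auslander class of a canonical module. -/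
lemma _root_.Paper.GCdimFinite.aus [Nontrivial R] [IsNoetherianRing R]
    (hω : IsCanonicalModule R ω) (hX : GCdimFinite R R X) : Aus s X := by
  have hS := hω.1.toSemi
  obtain ⟨m, hm⟩ := hω.2.exists_ev
  have hev : ∀ {X : Type u} [AddCommGroup X] [Module R X], TR R X → EV R X ω 1 := fun hX =>
    TR.ev_of_finite_injDim hm m 0 hX (by omega)
  obtain ⟨n, G, d, ε, hε, h0, hd, hG, hn⟩ := hX
  have hfin := fun i => (hG i).1
  have hA : ∀ i, Aus s (G i) := fun i => TR.toAus s hS hev (hG i).toTR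
  have hr : ∀ k i, n < i + k → Aus s (LinearMap.range (d i)) := by
    intro k
    induction k with
    | zero =>
      intro i hi
      have := hn (i + 1) (by omega)
      have : Subsingleton (LinearMap.range (d i)) := by
        rw [Submodule.subsingleton_iff_eq_bot, LinearMap.range_eq_bot]
        ext x
        rw [Subsingleton.elim x 0]; simp
      exact hS.aus_free s _
    | succ k ih =>
      intro i hi
      have h : SES (LinearMap.range (d (i + 1))).subtype (d i).rangeRestrict := by
        refine ⟨Subtype.val_injective, LinearMap.surjective_rangeRestrict _, fun y => ?_⟩
        rw [← LinearMap.mem_ker, LinearMap.ker_rangeRestrict, ← hd]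
        exact ⟨fun h => ⟨⟨y, h⟩, rfl⟩, fun ⟨x, hx⟩ => hx ▸ x.2⟩
      have h1 := ih (i + 1) (by omega)
      exact Aus.right s h h1 (hA _) (Aus.rTensor_injective s hS Subtype.val_injective h1 (hA _))
  have h : SES (LinearMap.range (d 0)).subtype ε := by
    refine ⟨Subtype.val_injective, hε, fun y => ?_⟩
    rw [← LinearMap.mem_ker, ← h0]
    exact ⟨fun h => ⟨⟨y, h⟩, rfl⟩, fun ⟨x, hx⟩ => hx ▸ x.2⟩
  have h1 := hr (n + 1) 0 (by omega)
  exact Aus.right s h h1 (hA 0) (Aus.rTensor_injective s hS Subtype.val_injective h1 (hA 0))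

end TotallyReflexiveAuslander

section BaseChange

variable {R : Type u} [CommRing R] {S : Type u} [CommRing S] [Algebra R S]
  {ω : Type u} [AddCommGroup ω] [Module R ω] (s : Syz R ω)
  {X : Type u} [AddCommGroup X] [Module R X] [Module S X] [IsScalarTower R S X]

lemma Syz.baseChange (hs : ∀ i, TV s S i) (i : ℕ) :
    SES ((s.ι i).baseChange S) ((s.π i).baseChange S) :=
  ⟨hs i, LinearMap.lTensor_surjective S (s.ses i).surj,
    lTensor_exact S (s.ses i).exact (s.ses i).surj⟩

lemma ev_baseChange_syz (hs : ∀ i, TV s S i) (i : ℕ) : ∀ j, EV R (s.K j) X (i + 1) →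
    EV S (S ⊗[R] s.K j) X (i + 1) := by
  induction i with
  | zero =>
    intro j hj
    refine (s.baseChange hs j).ev_one_of_extend (ev_projective 0) fun φ => ?_
    obtain ⟨ψ, hψ⟩ := (s.ses j).extend hj ((LinearMap.liftBaseChangeEquiv S).symm φ)
    refine ⟨LinearMap.liftBaseChangeEquiv S ψ, ?_⟩
    ext k
    have := LinearMap.congr_fun hψ k
    simpa using this
  | succ i ih =>
    intro j hj
    exact (s.baseChange hs j).con₃ (ih (j + 1) ((s.ses j).con₁ (ev_projective i) hj))
      (ev_projective _)

lemma ev_baseChange (hs : ∀ i, TV s S i) {i : ℕ} (h : EV R ω X (i + 1)) :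
    EV S (S ⊗[R] ω) X (i + 1) :=
  (ev_baseChange_syz s hs i 0 (h.congr_left s.iso.symm)).congr_left (s.iso.baseChange R S _ _)

/-- The base change of a semidualizing module whose ring of scalars lies in the Auslander class. -/
lemma Semi.baseChange (hω : Semi R ω) (hS : Aus s S) : Semi S (S ⊗[R] ω) where
  fin := have := hω.fin; inferInstance
  bij := by
    have : ⇑(LinearMap.lsmul S (S ⊗[R] ω)) =
        LinearMap.liftBaseChangeEquiv S ∘ TensorProduct.mk R S ω := by
      ext x : 1
      refine TensorProduct.AlgebraTensorModule.ext fun y w => ?_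
      simp [TensorProduct.smul_tmul', mul_comm]
    rw [this]
    exact (LinearMap.liftBaseChangeEquiv S).bijective.comp hS.bij
  ev i := ev_baseChange s hS.tv (hS.ev i)

end BaseChange

section QuotientBySequence

variable {R : Type u} [CommRing R]

/-- The quotient of a module by a sequence of ring elements, one element at a time. -/
def Quo : List R → ModuleCat.{u} R → ModuleCat.{u} R
  | [], M => M
  | x :: rs, M => Quo rs (ModuleCat.of R (QuotSMulTop x M))

/-- The projection onto the quotient by a sequence. -/
def Quo.mk : ∀ (rs : List R) (M : ModuleCat.{u} R), M →ₗ[R] Quo rs M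
  | [], _ => LinearMap.id
  | x :: rs, M => Quo.mk rs (ModuleCat.of R (QuotSMulTop x M)) ∘ₗ (x • (⊤ : Submodule R M)).mkQ

/-- Functoriality of the quotient by a sequence. -/
def Quo.map : ∀ (rs : List R) {M N : ModuleCat.{u} R} (_ : M →ₗ[R] N), Quo rs M →ₗ[R] Quo rs N
  | [], _, _, f => f
  | x :: rs, M, N, f => Quo.map rs (M := ModuleCat.of R (QuotSMulTop x M))
      (N := ModuleCat.of R (QuotSMulTop x N)) (QuotSMulTop.map x f)

/-- The quotient by a sequence respects linear equivalences. -/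
def Quo.congr : ∀ (rs : List R) {M N : ModuleCat.{u} R} (_ : M ≃ₗ[R] N), Quo rs M ≃ₗ[R] Quo rs N
  | [], _, _, e => e
  | x :: rs, M, N, e => Quo.congr rs (M := ModuleCat.of R (QuotSMulTop x M))
      (N := ModuleCat.of R (QuotSMulTop x N)) (QuotSMulTop.congr x e)

lemma Quo.mk_surjective : ∀ (rs : List R) (M : ModuleCat.{u} R),
    Function.Surjective (Quo.mk rs M)
  | [], _ => fun m => ⟨m, rfl⟩
  | _ :: rs, _ => (Quo.mk_surjective rs _).comp (Submodule.mkQ_surjective _)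

lemma Quo.map_mk : ∀ (rs : List R) {M N : ModuleCat.{u} R} (f : M →ₗ[R] N) (m : M),
    Quo.map rs f (Quo.mk rs M m) = Quo.mk rs N (f m)
  | [], _, _, _, _ => rfl
  | x :: rs, M, N, f, m => Quo.map_mk rs (M := ModuleCat.of R (QuotSMulTop x M))
      (N := ModuleCat.of R (QuotSMulTop x N)) (QuotSMulTop.map x f) (Submodule.Quotient.mk m)

lemma Quo.finite (rs : List R) (M : ModuleCat.{u} R) [Module.Finite R M] :
    Module.Finite R (Quo rs M) :=
  Module.Finite.of_surjective _ (Quo.mk_surjective rs M)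

/-- Every element of `rs` annihilates `L`. -/
def Kills (rs : List R) (L : Type u) [AddCommGroup L] [Module R L] : Prop :=
  ∀ r ∈ rs, ∀ y : L, r • y = 0

lemma Quo.kills : ∀ (rs : List R) (M : ModuleCat.{u} R), Kills rs (Quo rs M)
  | [], _ => fun _ h => by simp at h
  | x :: rs, M => by
    intro r hr y
    rcases List.mem_cons.1 hr with rfl | h
    · obtain ⟨m, rfl⟩ := Quo.mk_surjective _ _ y
      rw [← map_smul]
      change Quo.mk rs (ModuleCat.of R (QuotSMulTop r M))
        (Submodule.Quotient.mk (r • m)) = 0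
      rw [(Submodule.Quotient.mk_eq_zero _).2
        (Submodule.smul_mem_pointwise_smul _ _ _ Submodule.mem_top),
        map_zero]
    · exact Quo.kills rs _ r h y

variable {L L' : Type u} [AddCommGroup L] [Module R L] [AddCommGroup L'] [Module R L']

lemma Kills.of_injective {rs : List R} (h : Kills rs L) (f : L' →ₗ[R] L)
    (hf : Function.Injective f) : Kills rs L' := fun r hr y => hf (by
  rw [map_smul, map_zero, h r hr])

lemma Kills.head {x : R} {rs : List R} (h : Kills (x :: rs) L) (y : L) : x • y = 0 :=
  h x (by simp) y

lemma Kills.tail {x : R} {rs : List R} (h : Kills (x :: rs) L) : Kills rs L :=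
  fun r hr => h r (List.mem_cons_of_mem _ hr)

lemma Quo.lcomp_mk_bijective : ∀ (rs : List R) (M : ModuleCat.{u} R), Kills rs L →
    Function.Bijective (LinearMap.lcomp R L (Quo.mk rs M))
  | [], M, _ => Function.bijective_id
  | x :: rs, M, h => by
    have h1 := Quo.lcomp_mk_bijective rs (ModuleCat.of R (QuotSMulTop x M)) h.tail
    have h2 : Function.Bijective (LinearMap.lcomp R L (x • (⊤ : Submodule R M)).mkQ) := by
      constructor
      · intro φ ψ hφ
        ext m
        exact LinearMap.congr_fun hφ m
      · intro φ
        refine ⟨Submodule.liftQ _ φ ?_, by ext; rfl⟩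
        rintro _ ⟨y, -, rfl⟩
        change φ (x • y) = 0
        rw [map_smul, h.head]
    exact h2.comp h1

section Ext

lemma ext_smul_eq_zero {x : R} (h : ∀ y : L, x • y = 0) {X : Type u} [AddCommGroup X] [Module R X]
    {i : ℕ} (α : Abelian.Ext (ModuleCat.of R L) (ModuleCat.of R X) i) :
    α.comp (Abelian.Ext.mk₀ (ModuleCat.ofHom (LinearMap.lsmul R X x))) (add_zero i) = 0 := by
  have h1 : ModuleCat.ofHom (LinearMap.lsmul R X x) = x • 𝟙 (ModuleCat.of R X) := by
    ext; rfl
  have h2 : x • 𝟙 (ModuleCat.of R L) = 0 := by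
    ext y; exact h y
  rw [h1, Abelian.Ext.mk₀_smul, Abelian.Ext.comp_smul, Abelian.Ext.comp_mk₀_id,
    ← Abelian.Ext.mk₀_id_comp α, ← Abelian.Ext.smul_comp, ← Abelian.Ext.mk₀_smul, h2,
    Abelian.Ext.mk₀_zero, Abelian.Ext.zero_comp]

variable {X : Type u} [AddCommGroup X] [Module R X]

/-- The connecting map `Ext^n(L, X/xX) → Ext^{n+1}(L, X)`. -/
def extShift {x : R} (hx : IsSMulRegular X x) (L : Type u) [AddCommGroup L] [Module R L] (n : ℕ) :
    Abelian.Ext (ModuleCat.of R L) (ModuleCat.of R (QuotSMulTop x X)) n →ₗ[R]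
      Abelian.Ext (ModuleCat.of R L) (ModuleCat.of R X) (n + 1) where
  toFun α := α.comp (SES.smul x hx).shortExact.extClass rfl
  map_add' _ _ := Abelian.Ext.add_comp _ _ _ _
  map_smul' _ _ := Abelian.Ext.smul_comp _ _ _ _

lemma extShift_surjective {x : R} (hx : IsSMulRegular X x) (h : ∀ y : L, x • y = 0) (n : ℕ) :
    Function.Surjective (extShift hx L n) := fun α =>
  Abelian.Ext.covariant_sequence_exact₁ (ModuleCat.of R L) (SES.smul x hx).shortExact α
    (ext_smul_eq_zero h α) rfl

lemma extShift_injective {x : R} (hx : IsSMulRegular X x) {n : ℕ} (hL : EV R L X n) :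
    Function.Injective (extShift hx L n) := by
  rw [injective_iff_map_eq_zero]
  intro α hα
  obtain ⟨y, rfl⟩ := Abelian.Ext.covariant_sequence_exact₃ (ModuleCat.of R L)
    (SES.smul x hx).shortExact α rfl hα
  rw [show y = 0 from hL.elim _ _, Abelian.Ext.zero_comp]

lemma ev_of_kills : ∀ (rs : List R) (X : ModuleCat.{u} R), Kills rs L →
    RingTheory.Sequence.IsWeaklyRegular X rs → ∀ i < rs.length, EV R L X i
  | [], _, _, _ => fun i hi => by simp at hi
  | x :: rs, X, h, hX => by
    rw [RingTheory.Sequence.isWeaklyRegular_cons_iff] at hX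
    rintro (_ | i) hi
    · rw [ev_zero_iff]
      refine subsingleton_of_forall_eq 0 fun φ => ?_
      ext y
      refine hX.1 ?_
      change x • φ y = x • 0
      rw [← map_smul, h.head, map_zero, smul_zero]
    · have := ev_of_kills rs (ModuleCat.of R (QuotSMulTop x X)) h.tail hX.2 i (by simpa using hi)
      exact (extShift_surjective hX.1 h.head i).subsingleton

lemma exists_ext_equiv_hom_quo : ∀ (rs : List R) (X : ModuleCat.{u} R), Kills rs L →
    RingTheory.Sequence.IsWeaklyRegular X rs →
    Nonempty (Abelian.Ext (ModuleCat.of R L) (ModuleCat.of R X) rs.length ≃ₗ[R]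
      (L →ₗ[R] Quo rs X))
  | [], X, _, _ => ⟨(Abelian.Ext.linearEquiv₀ (R := R)).trans ModuleCat.homLinearEquiv⟩
  | x :: rs, X, h, hX => by
    have hX' := (RingTheory.Sequence.isWeaklyRegular_cons_iff _ _ _).1 hX
    obtain ⟨e⟩ := exists_ext_equiv_hom_quo rs (ModuleCat.of R (QuotSMulTop x X)) h.tail hX'.2
    have h1 : Function.Bijective (extShift hX'.1 L rs.length) :=
      ⟨extShift_injective hX'.1 (ev_of_kills (x :: rs) X h hX _ (by simp)),
        extShift_surjective hX'.1 h.head _⟩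
    exact ⟨(LinearEquiv.ofBijective _ h1).symm.trans e⟩

lemma extend_of_kills (ι : L' →ₗ[R] L) (hι : Function.Injective ι) :
    ∀ (rs : List R) (X : ModuleCat.{u} R), Kills rs L →
    RingTheory.Sequence.IsWeaklyRegular X rs →
    (∀ α : Abelian.Ext (ModuleCat.of R L') (ModuleCat.of R X) rs.length,
      ∃ β : Abelian.Ext (ModuleCat.of R L) (ModuleCat.of R X) rs.length,
        (Abelian.Ext.mk₀ (ModuleCat.ofHom ι)).comp β (zero_add _) = α) →
    ∀ φ : L' →ₗ[R] Quo rs X, ∃ ψ : L →ₗ[R] Quo rs X, ψ ∘ₗ ι = φ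
  | [], X, _, _ => by
    intro H φ
    obtain ⟨y, hy⟩ := H (Abelian.Ext.mk₀ (ModuleCat.ofHom φ))
    obtain ⟨ψ, rfl⟩ := (Abelian.Ext.mk₀_bijective _ _).surjective y
    rw [Abelian.Ext.mk₀_comp_mk₀] at hy
    have := (Abelian.Ext.mk₀_bijective _ _).injective hy
    exact ⟨ψ.hom, congrArg ModuleCat.Hom.hom this⟩
  | x :: rs, X, h, hX => by
    intro H
    have hX' := (RingTheory.Sequence.isWeaklyRegular_cons_iff _ _ _).1 hX
    refine extend_of_kills ι hι rs (ModuleCat.of R (QuotSMulTop x X)) h.tail hX'.2 fun α => ?_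
    obtain ⟨β, hβ⟩ := H (extShift hX'.1 L' rs.length α)
    obtain ⟨γ, rfl⟩ := extShift_surjective hX'.1 h.head _ β
    refine ⟨γ, extShift_injective hX'.1 (ev_of_kills (x :: rs) X (h.of_injective ι hι) hX _
      (by simp)) ?_⟩
    rw [← hβ]
    exact Abelian.Ext.comp_assoc _ _ _ (zero_add _) rfl (by omega)

lemma extend_of_kills_of_ev (ι : L' →ₗ[R] L) (hι : Function.Injective ι) (rs : List R)
    (X : ModuleCat.{u} R) (hL : Kills rs L) (hX : RingTheory.Sequence.IsWeaklyRegular X rs)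
    (h : EV R (L ⧸ LinearMap.range ι) X (rs.length + 1)) (φ : L' →ₗ[R] Quo rs X) :
    ∃ ψ : L →ₗ[R] Quo rs X, ψ ∘ₗ ι = φ := by
  have k : SES ι (LinearMap.range ι).mkQ :=
    ⟨hι, Submodule.mkQ_surjective _, LinearMap.exact_map_mkQ_range ι⟩
  refine extend_of_kills ι hι rs X hL hX (fun α => ?_) φ
  exact Abelian.Ext.contravariant_sequence_exact₁ k.shortExact (ModuleCat.of R X) α
    (Nat.add_comm 1 _) (h.elim _ _)

end Ext

end QuotientBySequence

section HomQuotient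

variable {R : Type u} [CommRing R] {C X Y N : Type u} [AddCommGroup C] [Module R C]
  [AddCommGroup X] [Module R X] [AddCommGroup Y] [Module R Y] [AddCommGroup N] [Module R N]

open RingTheory.Sequence

/-- If `Ext¹(C, X) = 0` then `Hom(C, X)/x ≅ Hom(C, X/xX)` for an `X`-regular element `x`. -/
def quotSMulTopHomEquiv {x : R} (hx : IsSMulRegular X x) (h : EV R C X 1) :
    QuotSMulTop x (C →ₗ[R] X) ≃ₗ[R] (C →ₗ[R] QuotSMulTop x X) :=
  (Submodule.quotEquivOfEq _ (LinearMap.ker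
    ((x • (⊤ : Submodule R X)).mkQ.compRight R (M := C))) (by
      ext φ
      rw [LinearMap.mem_ker, Submodule.mem_smul_pointwise_iff_exists]
      constructor
      · rintro ⟨ψ, -, rfl⟩
        ext c
        exact (Submodule.Quotient.mk_eq_zero _).2
          (Submodule.smul_mem_pointwise_smul _ _ _ Submodule.mem_top)
      · intro hφ
        have h1 : ∀ c, φ c ∈ LinearMap.range (LinearMap.lsmul R X x) := fun c =>
          ((SES.smul x hx).exact _).1 (LinearMap.congr_fun hφ c)
        refine ⟨(LinearEquiv.ofInjective _ (SES.smul x hx).inj).symm.toLinearMap ∘ₗ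
          φ.codRestrict _ h1, Submodule.mem_top, ?_⟩
        ext c
        exact congrArg Subtype.val (LinearEquiv.apply_symm_apply
          (LinearEquiv.ofInjective _ (SES.smul x hx).inj) (φ.codRestrict _ h1 c)))).trans
  (LinearMap.quotKerEquivOfSurjective _ fun φ => (SES.smul x hx).lift h φ)

lemma ev_quotSMulTop {x : R} (hx : IsSMulRegular X x) (h : ∀ i, EV R C X (i + 1)) (i : ℕ) :
    EV R C (QuotSMulTop x X) (i + 1) :=
  (SES.smul x hx).cov₃ (h i) (h (i + 1))

lemma exists_quo_hom_equiv : ∀ (rs : List R) (X : ModuleCat.{u} R), (∀ i, EV R C X (i + 1)) →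
    IsWeaklyRegular X rs →
    Nonempty (Quo rs (ModuleCat.of R (C →ₗ[R] X)) ≃ₗ[R] (C →ₗ[R] Quo rs X))
  | [], _, _, _ => ⟨LinearEquiv.refl _ _⟩
  | x :: rs, X, h, hX => by
    rw [isWeaklyRegular_cons_iff] at hX
    obtain ⟨e⟩ := exists_quo_hom_equiv rs (ModuleCat.of R (QuotSMulTop x X))
      (ev_quotSMulTop hX.1 h) hX.2
    exact ⟨(Quo.congr rs (M := ModuleCat.of R (QuotSMulTop x (C →ₗ[R] X)))
      (N := ModuleCat.of R (C →ₗ[R] QuotSMulTop x X)) (quotSMulTopHomEquiv hX.1 (h 0))).trans e⟩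

lemma exists_lift_quo : ∀ (rs : List R) (X : ModuleCat.{u} R), (∀ i, EV R C X (i + 1)) →
    IsWeaklyRegular X rs → ∀ φ : C →ₗ[R] Quo rs X, ∃ ψ : C →ₗ[R] X, Quo.mk rs X ∘ₗ ψ = φ
  | [], _, _, _ => fun φ => ⟨φ, rfl⟩
  | x :: rs, X, h, hX => by
    intro φ
    rw [isWeaklyRegular_cons_iff] at hX
    obtain ⟨ψ, hψ⟩ := exists_lift_quo rs (ModuleCat.of R (QuotSMulTop x X))
      (ev_quotSMulTop hX.1 h) hX.2 φ
    obtain ⟨χ, rfl⟩ := (SES.smul x hX.1).lift (h 0) ψ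
    exact ⟨χ, hψ⟩

lemma isWeaklyRegular_hom : ∀ (rs : List R) (X : ModuleCat.{u} R), (∀ i, EV R C X (i + 1)) →
    IsWeaklyRegular X rs → IsWeaklyRegular (C →ₗ[R] X) rs
  | [], _, _, _ => IsWeaklyRegular.nil _ _
  | x :: rs, X, h, hX => by
    rw [isWeaklyRegular_cons_iff] at hX ⊢
    refine ⟨fun φ ψ hφ => LinearMap.ext fun c => hX.1 (LinearMap.congr_fun hφ c), ?_⟩
    rw [LinearEquiv.isWeaklyRegular_congr (quotSMulTopHomEquiv hX.1 (h 0))]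
    exact isWeaklyRegular_hom rs (ModuleCat.of R (QuotSMulTop x X)) (ev_quotSMulTop hX.1 h) hX.2

lemma isSMulRegular_of_hom [IsNoetherianRing R] [Module.Finite R C] [Module.Finite R X]
    (hC : Function.Injective (LinearMap.lsmul R C)) {x : R} (h : IsSMulRegular (C →ₗ[R] X) x) :
    IsSMulRegular X x := by
  have h1 : Subsingleton (C →ₗ[R] LinearMap.ker (LinearMap.lsmul R X x)) := by
    refine subsingleton_of_forall_eq 0 fun φ => ?_
    have : (LinearMap.ker (LinearMap.lsmul R X x)).subtype ∘ₗ φ = 0 := h (by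
      ext c
      change x • (φ c : X) = x • (0 : X)
      rw [smul_zero]
      exact (φ c).2)
    ext c
    exact LinearMap.congr_fun this c
  have h2 := subsingleton_of_hom_subsingleton hC h1
  exact LinearMap.ker_eq_bot.1 (Submodule.subsingleton_iff_eq_bot.1 h2)

lemma isWeaklyRegular_of_hom [IsNoetherianRing R] [Module.Finite R C]
    (hC : Function.Injective (LinearMap.lsmul R C)) : ∀ (rs : List R) (X : ModuleCat.{u} R)
    [Module.Finite R X], (∀ i, EV R C X (i + 1)) → IsWeaklyRegular (C →ₗ[R] X) rs →
      IsWeaklyRegular X rs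
  | [], _, _, _, _ => IsWeaklyRegular.nil _ _
  | x :: rs, X, _, h, hX => by
    rw [isWeaklyRegular_cons_iff] at hX ⊢
    have h1 := isSMulRegular_of_hom hC hX.1
    refine ⟨h1, isWeaklyRegular_of_hom hC rs (ModuleCat.of R (QuotSMulTop x X))
      (ev_quotSMulTop h1 h) ?_⟩
    exact (LinearEquiv.isWeaklyRegular_congr (quotSMulTopHomEquiv h1 (h 0)) rs).1 hX.2

lemma ev_quo : ∀ (rs : List R) (X : ModuleCat.{u} R)
    (k : ℕ), (∀ i, k < i → EV R X N i) → IsWeaklyRegular X rs → ∀ i, k + rs.length < i →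
    EV R (Quo rs X) N i
  | [], _, _, h, _, i, hi => h i hi
  | x :: rs, X, k, h, hX, i, hi => by
    rw [isWeaklyRegular_cons_iff] at hX
    rw [List.length_cons] at hi
    refine ev_quo rs (ModuleCat.of R (QuotSMulTop x X)) (k + 1) (fun j hj => ?_) hX.2 i (by omega)
    obtain ⟨j, rfl⟩ : ∃ j', j = j' + 1 := ⟨j - 1, by omega⟩
    exact (SES.smul x hX.1).con₃ (h j (by omega)) (h (j + 1) (by omega))

end HomQuotient

section Nakayama

open RingTheory.Sequence IsLocalRing

variable {R : Type u} [CommRing R] [IsLocalRing R]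

lemma surjective_of_quo_map : ∀ (rs : List R) (_ : ∀ r ∈ rs, r ∈ maximalIdeal R)
    {X Y : ModuleCat.{u} R} [Module.Finite R Y] (f : X →ₗ[R] Y),
    Function.Surjective (Quo.map rs f) → Function.Surjective f
  | [], _, _, _, _, _, h => h
  | x :: rs, hrs, X, Y, _, f, h => by
    have h1 := surjective_of_quo_map rs (fun r hr => hrs r (List.mem_cons_of_mem _ hr))
      (X := ModuleCat.of R (QuotSMulTop x X)) (Y := ModuleCat.of R (QuotSMulTop x Y)) _ h
    rw [← LinearMap.range_eq_top, ← top_le_iff]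
    refine Submodule.le_of_le_smul_of_le_jacobson_bot (I := maximalIdeal R) Module.Finite.fg_top
      (maximalIdeal_le_jacobson _) fun y _ => ?_
    obtain ⟨z, hz⟩ := h1 (Submodule.Quotient.mk y)
    obtain ⟨w, rfl⟩ := Submodule.Quotient.mk_surjective _ z
    have : y - f w ∈ x • (⊤ : Submodule R Y) :=
      (Submodule.Quotient.eq _).1 hz.symm
    obtain ⟨t, -, ht⟩ := (Submodule.mem_smul_pointwise_iff_exists _ _ _).1 this
    rw [show y = f w + x • t by rw [ht]; abel]
    exact Submodule.add_mem_sup ⟨w, rfl⟩ (Submodule.smul_mem_smul (hrs x (by simp)) trivial)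

lemma injective_of_quo_map [IsNoetherianRing R] : ∀ (rs : List R)
    (_ : ∀ r ∈ rs, r ∈ maximalIdeal R) {X Y : ModuleCat.{u} R} [Module.Finite R X] (f : X →ₗ[R] Y),
    IsWeaklyRegular Y rs → Function.Injective (Quo.map rs f) → Function.Injective f
  | [], _, _, _, _, _, _, h => h
  | x :: rs, hrs, X, Y, _, f, hY, h => by
    rw [isWeaklyRegular_cons_iff] at hY
    have h1 := injective_of_quo_map rs (fun r hr => hrs r (List.mem_cons_of_mem _ hr))
      (X := ModuleCat.of R (QuotSMulTop x X)) (Y := ModuleCat.of R (QuotSMulTop x Y)) _ hY.2 h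
    rw [← LinearMap.ker_eq_bot]
    refine Submodule.eq_bot_of_le_smul_of_le_jacobson_bot (maximalIdeal R) _
      (IsNoetherian.noetherian _) (fun y hy => ?_) (maximalIdeal_le_jacobson _)
    have h2 : (Submodule.Quotient.mk y : QuotSMulTop x X) = 0 := h1 (by
      change Submodule.Quotient.mk (f y) = _
      rw [LinearMap.mem_ker.1 hy, map_zero]; rfl)
    obtain ⟨t, -, rfl⟩ := (Submodule.mem_smul_pointwise_iff_exists _ _ _).1
      ((Submodule.Quotient.mk_eq_zero _).1 h2)
    refine Submodule.smul_mem_smul (hrs x (by simp)) (hY.1 ?_)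
    change x • f t = x • 0
    rw [← map_smul, LinearMap.mem_ker.1 hy, smul_zero]

lemma ev_of_isWeaklyRegular [IsNoetherianRing R] {N : Type u} [AddCommGroup N] [Module R N]
    [Module.Finite R N] {k : ℕ} (hN : ∀ (L : ModuleCat.{u} R), Module.Finite R L → ∀ i, k < i →
      EV R L N i) : ∀ (rs : List R) (_ : ∀ r ∈ rs, r ∈ maximalIdeal R) (X : ModuleCat.{u} R)
    [Module.Finite R X], IsWeaklyRegular X rs → ∀ i, k < i + rs.length → EV R X N i
  | [], _, X, hX, _, i, hi => hN X hX i hi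
  | x :: rs, hrs, X, _, h, i, hi => by
    rw [isWeaklyRegular_cons_iff] at h
    rw [List.length_cons] at hi
    exact ev_of_quotient_smul (hrs x (by simp)) h.1 (ev_of_isWeaklyRegular hN rs
      (fun r hr => hrs r (List.mem_cons_of_mem _ hr)) (ModuleCat.of R (QuotSMulTop x X)) h.2 (i + 1)
      (by omega))

end Nakayama

section Local

open RingTheory.Sequence IsLocalRing

variable {R : Type u} [CommRing R] [IsNoetherianRing R]

lemma isFiniteLength_of_kills {rs : List R} (h : ringKrullDim (R ⧸ Ideal.ofList rs) ≤ 0)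
    {L : Type u} [AddCommGroup L] [Module R L] [Module.Finite R L] (hL : Kills rs L) :
    IsFiniteLength R L := by
  have h1 : Ideal.ofList rs ≤ Module.annihilator R L :=
    Ideal.span_le.2 fun r hr => Module.mem_annihilator.2 (hL r hr)
  have h2 : Module.IsTorsionBySet R L (Ideal.ofList rs) :=
    (Module.isTorsionBySet_iff_subset_annihilator R L).2 h1
  let _ : Module (R ⧸ Ideal.ofList rs) L := h2.module
  have : IsScalarTower R (R ⧸ Ideal.ofList rs) L := h2.isScalarTower
  have : Module.Finite (R ⧸ Ideal.ofList rs) L :=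
    Module.Finite.of_restrictScalars_finite R _ L
  have : IsArtinianRing (R ⧸ Ideal.ofList rs) := by
    rw [isArtinianRing_iff_krullDimLE_zero, Ring.krullDimLE_iff]
    exact_mod_cast h
  rw [← Module.length_ne_top_iff,
    Module.length_eq_of_surjective (R := R ⧸ Ideal.ofList rs) Ideal.Quotient.mk_surjective]
  exact Module.length_ne_top

variable [IsLocalRing R]

omit [IsNoetherianRing R] in
lemma exists_residue_injective {L : Type u} [AddCommGroup L] [Module R L] [Nontrivial L]
    (hL : IsFiniteLength R L) : ∃ ι : (R ⧸ maximalIdeal R) →ₗ[R] L, Function.Injective ι := by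
  have := (isFiniteLength_iff_isNoetherian_isArtinian.1 hL).2
  obtain ⟨K, hK, -⟩ := (IsAtomic.eq_bot_or_exists_atom_le (⊤ : Submodule R L)).resolve_left
    top_ne_bot
  have hs := isSimpleModule_iff_isAtom.2 hK
  obtain ⟨I, hI, ⟨e⟩⟩ := isSimpleModule_iff_quot_maximal.1 hs
  obtain rfl := eq_maximalIdeal hI
  exact ⟨K.subtype ∘ₗ e.symm.toLinearMap, K.subtype_injective.comp e.symm.injective⟩

omit [IsNoetherianRing R] in
lemma nontrivial_quo : ∀ (rs : List R) (_ : ∀ r ∈ rs, r ∈ maximalIdeal R) (X : ModuleCat.{u} R)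
    [Module.Finite R X] [Nontrivial X], Nontrivial (Quo rs X)
  | [], _, X, _, h => h
  | x :: rs, hrs, X, _, _ => by
    have := nontrivial_quotSMulTop_of_mem_maximalIdeal (R := R) X (hrs x (by simp))
    exact nontrivial_quo rs (fun r hr => hrs r (List.mem_cons_of_mem _ hr))
      (ModuleCat.of R (QuotSMulTop x X))

variable {N : Type u} [AddCommGroup N] [Module R N] [Module.Finite R N]

/-- If a module `Q` contains the residue field and `Extⁱ(Q, N) = 0` for `i > d`, then a finite
module `N` of finite injective dimension has injective dimension at most `d`. -/
lemma ev_of_residue_injective {n d : ℕ} (hn : ∀ (L : ModuleCat.{u} R) i, n < i → EV R L N i)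
    {Q : Type u} [AddCommGroup Q] [Module R Q] [Module.Finite R Q]
    (ι : (R ⧸ maximalIdeal R) →ₗ[R] Q)
    (hι : Function.Injective ι) (hQ : ∀ i, d < i → EV R Q N i) (L : Type u) [AddCommGroup L]
    [Module R L] [Module.Finite R L] (i : ℕ) (hi : d < i) : EV R L N i := by
  suffices ∀ (j i : ℕ), d < i → n < i + j → ∀ (L : Type u) [AddCommGroup L] [Module R L]
      [Module.Finite R L], EV R L N i from this (n + 1) i hi (by omega) L
  intro j
  induction j with
  | zero => exact fun i _ hi' L _ _ _ => hn (ModuleCat.of R L) i hi'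
  | succ j ih =>
    intro i hi hi' L _ _ _
    have ih' := ih (i + 1) (by omega) (by omega)
    induction ‹Module.Finite R L› using
      IsNoetherianRing.induction_on_isQuotientEquivQuotientPrime R with
    | subsingleton L => exact ev_of_subsingleton_left _
    | quotient L p e =>
      refine EV.congr_left e.symm ?_
      by_cases hp : p.1 = maximalIdeal R
      · rw [hp]
        have k : SES ι (LinearMap.range ι).mkQ :=
          ⟨hι, Submodule.mkQ_surjective _, LinearMap.exact_map_mkQ_range ι⟩
        exact k.con₁ (hQ i hi) (ih' _)
      · obtain ⟨x, hx, hxp⟩ := SetLike.exists_of_lt (lt_of_le_of_ne (le_maximalIdeal p.2.ne_top) hp)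
        refine ev_of_quotient_smul hx (fun a b hab => ?_) (ih' _)
        obtain ⟨a, rfl⟩ := Ideal.Quotient.mk_surjective a
        obtain ⟨b, rfl⟩ := Ideal.Quotient.mk_surjective b
        change Ideal.Quotient.mk p.1 (x * a) = Ideal.Quotient.mk p.1 (x * b) at hab
        rw [Ideal.Quotient.eq, ← mul_sub] at hab
        exact Ideal.Quotient.eq.2 ((p.2.mem_or_mem hab).resolve_left hxp)
    | exact L₁ L₂ L₃ f g hf hg hfg h₁ h₃ => exact SES.con₂ ⟨hf, hg, hfg⟩ h₁ h₃

variable {X : Type u} [AddCommGroup X] [Module R X] [Module.Finite R X]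

omit [IsNoetherianRing R] [Module.Finite R X] in
lemma le_ldepth_iff {n : ℕ} :
    (n : ℕ∞) ≤ ldepth R X ↔ ∀ i < n, EV R (R ⧸ maximalIdeal R) X i := by
  rw [ldepth, edepth, le_sInf_iff]
  constructor
  · intro h i hi
    by_contra h1
    rw [← subsingleton_extGrp_iff, not_subsingleton_iff_nontrivial] at h1
    exact absurd (h i ⟨i, rfl, h1⟩) (not_le.2 (by exact_mod_cast hi))
  · rintro h _ ⟨i, rfl, h1⟩
    by_contra h2
    rw [← not_subsingleton_iff_nontrivial, subsingleton_extGrp_iff] at h1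
    exact h1 (h i (by exact_mod_cast not_le.1 h2))

/-- Depth is detected by regular sequences. -/
lemma le_ldepth_iff_exists [Nontrivial X] {n : ℕ} : (n : ℕ∞) ≤ ldepth R X ↔
    ∃ rs : List R, rs.length = n ∧ (∀ r ∈ rs, r ∈ maximalIdeal R) ∧ IsRegular X rs := by
  have h1 : maximalIdeal R • (⊤ : Submodule R X) < ⊤ :=
    lt_top_iff_ne_top.2 (Ne.symm (Submodule.top_ne_ideal_smul_of_le_jacobson_annihilator
      (maximalIdeal_le_jacobson _)))
  have h2 : Module.support R (R ⧸ maximalIdeal R) = PrimeSpectrum.zeroLocus (maximalIdeal R) := by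
    rw [Module.support_eq_zeroLocus, Ideal.annihilator_quotient]
  rw [le_ldepth_iff]
  constructor
  · exact ModuleCat.exists_isRegular_of_exists_subsingleton_ext (maximalIdeal R) n
      (ModuleCat.of R X) h1 (ModuleCat.of R (R ⧸ maximalIdeal R)) h2
  · rintro ⟨rs, rfl, hm, hr⟩
    exact ModuleCat.subsingleton_ext_of_exists_isRegular (maximalIdeal R)
      (ModuleCat.of R (R ⧸ maximalIdeal R)) h2.subset (ModuleCat.of R X) h1 rs hm hr

end Local

section ArtinianDuality

open IsLocalRing

variable {R : Type u} [CommRing R] [IsNoetherianRing R] [IsLocalRing R]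
variable {V D E : Type u} [AddCommGroup V] [Module R V] [Module.Finite R V]
  [AddCommGroup D] [Module R D] [Module.Finite R D] [AddCommGroup E] [Module R E]
  [Module.Finite R E]

omit [IsNoetherianRing R] [Module.Finite R D] in
lemma length_hom_of_residue (hV : ∀ r ∈ maximalIdeal R, ∀ v : V, r • v = 0) :
    Module.length R (V →ₗ[R] D) =
      Module.length R V * Module.length R ((R ⧸ maximalIdeal R) →ₗ[R] D) := by
  have h2 : Module.IsTorsionBySet R V (maximalIdeal R) :=
    (Module.isTorsionBySet_iff_subset_annihilator R V).2
      fun r hr => Module.mem_annihilator.2 (hV r hr)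
  let _ : Module (R ⧸ maximalIdeal R) V := h2.module
  have : IsScalarTower R (R ⧸ maximalIdeal R) V := h2.isScalarTower
  have : Module.Finite (R ⧸ maximalIdeal R) V := Module.Finite.of_restrictScalars_finite R _ V
  let _ : Field (R ⧸ maximalIdeal R) := Ideal.Quotient.field _
  obtain ⟨n, ⟨b⟩⟩ : ∃ n, Nonempty (Module.Basis (Fin n) (R ⧸ maximalIdeal R) V) :=
    ⟨_, ⟨Module.finBasis _ _⟩⟩
  have e : V ≃ₗ[R] (Fin n → R ⧸ maximalIdeal R) := b.equivFun.restrictScalars R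
  have : IsSimpleModule R (R ⧸ maximalIdeal R) :=
    isSimpleModule_iff_quot_maximal.2 ⟨_, inferInstance, ⟨LinearEquiv.refl _ _⟩⟩
  rw [e.length_eq, (e.arrowCongr (LinearEquiv.refl R D)).length_eq,
    ← (LinearMap.lsum R (fun _ : Fin n => R ⧸ maximalIdeal R) R).length_eq,
    Module.length_pi_of_fintype, Module.length_pi_of_fintype]
  simp [Module.length_eq_one]

variable {rs : List R}

/-- `E` is injective relative to the finite modules killed by `rs`. -/
def RelInjective (rs : List R) (E : Type u) [AddCommGroup E] [Module R E] : Prop :=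
  ∀ (L' L : ModuleCat.{u} R) [Module.Finite R L] (ι : L' →ₗ[R] L), Function.Injective ι →
    Kills rs L → ∀ φ : L' →ₗ[R] E, ∃ ψ : L →ₗ[R] E, ψ ∘ₗ ι = φ

omit [IsNoetherianRing R] [Module.Finite R E] in
lemma RelInjective.length_hom (hE : RelInjective rs E) {L : Type u} [AddCommGroup L] [Module R L]
    (hL : IsFiniteLength R L) (hk : Kills rs L) : Module.length R (L →ₗ[R] E) =
      Module.length R L * Module.length R ((R ⧸ maximalIdeal R) →ₗ[R] E) := by
  induction hL with
  | of_subsingleton => simp [Module.length_eq_zero]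
  | @of_simple_quotient L _ _ K hs hK ih =>
    have hfin := (isFiniteLength_iff_isNoetherian_isArtinian.1
      (IsFiniteLength.of_simple_quotient hK)).1
    obtain ⟨I, hI, ⟨e⟩⟩ := isSimpleModule_iff_quot_maximal.1 hs
    obtain rfl := eq_maximalIdeal hI
    rw [Module.length_eq_add_of_exact (LinearMap.lcomp R E K.mkQ) (LinearMap.lcomp R E K.subtype)
      ?_ ?_ ?_, Module.length_eq_add_of_exact K.subtype K.mkQ K.subtype_injective
      K.mkQ_surjective (LinearMap.exact_subtype_mkQ K),
      ih (hk.of_injective K.subtype K.subtype_injective), Module.length_eq_one R (L ⧸ K), add_mul,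
      one_mul, (e.arrowCongr (LinearEquiv.refl R E)).length_eq, add_comm]
    · intro f g h
      exact LinearMap.ext fun x => by
        obtain ⟨x, rfl⟩ := K.mkQ_surjective x
        exact LinearMap.congr_fun h x
    · exact hE (ModuleCat.of R K) (ModuleCat.of R L) K.subtype K.subtype_injective hk
    · intro f
      constructor
      · intro hf
        refine ⟨K.liftQ f fun x hx => LinearMap.congr_fun hf ⟨x, hx⟩, ?_⟩
        ext x; rfl
      · rintro ⟨g, rfl⟩
        ext x
        change g (Submodule.Quotient.mk (x : L)) = 0
        rw [(Submodule.Quotient.mk_eq_zero K).2 x.2, map_zero]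

variable (hdim : ringKrullDim (R ⧸ Ideal.ofList rs) ≤ 0) (hrs : ∀ r ∈ rs, r ∈ maximalIdeal R)

include hdim hrs

lemma RelInjective.length_hom_residue (hE : RelInjective rs E) (hk : Kills rs E)
    (hEE : Module.length R (E →ₗ[R] E) = Module.length R (Quo rs (ModuleCat.of R R))) :
    Module.length R ((R ⧸ maximalIdeal R) →ₗ[R] E) = 1 ∧
      Module.length R E = Module.length R (Quo rs (ModuleCat.of R R)) := by
  have := Quo.finite rs (ModuleCat.of R R)
  have hA := isFiniteLength_of_kills hdim (Quo.kills rs (ModuleCat.of R R))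
  have hAk := hE.length_hom hA (Quo.kills rs (ModuleCat.of R R))
  have hEk := hE.length_hom (isFiniteLength_of_kills hdim hk) hk
  have e := (LinearEquiv.ofBijective _
    (Quo.lcomp_mk_bijective rs (ModuleCat.of R R) hk)).trans (LinearMap.ringLmapEquivSelf R R E)
  rw [e.length_eq] at hAk
  rw [hEE] at hEk
  have h0 : Module.length R (Quo rs (ModuleCat.of R R)) ≠ 0 := by
    have := nontrivial_quo rs hrs (ModuleCat.of R R)
    exact Module.length_pos.ne'
  have ht := Module.length_ne_top_iff.2 hA
  generalize Module.length R (Quo rs (ModuleCat.of R R)) = a at *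
  have ht' := Module.length_ne_top_iff.2 (isFiniteLength_of_kills hdim hk)
  generalize Module.length R E = b at *
  generalize Module.length R ((R ⧸ maximalIdeal R) →ₗ[R] E) = r at *
  lift a to ℕ using ht
  lift b to ℕ using ht'
  have hr : r ≠ ⊤ := by
    rintro rfl
    rw [ENat.mul_top h0] at hAk
    exact ENat.natCast_ne_top _ hAk
  lift r to ℕ using hr
  norm_cast at *
  have h1 : a * (r * r) = a * 1 := by rw [← mul_assoc, ← hAk, ← hEk, mul_one]
  have h2 := Nat.eq_of_mul_eq_mul_left (Nat.pos_of_ne_zero h0) h1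
  have h3 : r = 1 := Nat.eq_one_of_mul_eq_one_left h2
  subst h3
  exact ⟨rfl, by rw [hAk, mul_one]⟩

lemma RelInjective.exists_equiv (hE : RelInjective rs E) (hk : Kills rs E)
    (hEE : Module.length R (E →ₗ[R] E) = Module.length R (Quo rs (ModuleCat.of R R)))
    (hkD : Kills rs D)
    (hDD : Module.length R (D →ₗ[R] D) = Module.length R (Quo rs (ModuleCat.of R R)))
    (hD : Module.length R ((R ⧸ maximalIdeal R) →ₗ[R] D) = 1) : Nonempty (D ≃ₗ[R] E) := by
  obtain ⟨hE1, hEA⟩ := hE.length_hom_residue hdim hrs hk hEE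
  have hEf := isFiniteLength_of_kills hdim hk
  have hDf := isFiniteLength_of_kills hdim hkD
  have : Nontrivial D := by
    by_contra h
    rw [not_nontrivial_iff_subsingleton] at h
    simp [Module.length_eq_zero] at hD
  have : Nontrivial E := by
    by_contra h
    rw [not_nontrivial_iff_subsingleton] at h
    simp [Module.length_eq_zero] at hE1
  obtain ⟨ι, hι⟩ := exists_residue_injective hDf
  obtain ⟨j, hj⟩ := exists_residue_injective hEf
  obtain ⟨g, hg⟩ := hE (ModuleCat.of R (R ⧸ maximalIdeal R)) (ModuleCat.of R D) ι hι hkD j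
  have hsimple := Module.length_eq_one_iff.1 hD
  have hg1 : Function.Injective g := by
    rw [← LinearMap.ker_eq_bot]
    by_contra hne
    have := Submodule.nontrivial_iff_ne_bot.2 hne
    have hkf : IsFiniteLength R (LinearMap.ker g) := isFiniteLength_of_kills hdim
      (hkD.of_injective (LinearMap.ker g).subtype (LinearMap.ker g).subtype_injective)
    obtain ⟨κ, hκ⟩ := exists_residue_injective hkf
    have hι0 : ι ≠ 0 := by
      rintro rfl
      exact one_ne_zero (hι (a₁ := 1) (a₂ := 0) rfl)
    obtain ⟨c, hc⟩ := Submodule.mem_span_singleton.1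
      ((IsSimpleModule.span_singleton_eq_top R hι0).ge (Submodule.mem_top (x := (LinearMap.ker g).subtype ∘ₗ κ)))
    have h1 : (c • (1 : R ⧸ maximalIdeal R)) = 0 := hj (by
      rw [map_zero, ← hg, map_smul]
      change c • g (ι 1) = 0
      rw [← map_smul]
      change g ((c • ι) 1) = 0
      rw [hc]
      exact (κ 1).2)
    have h2 : (κ 1 : D) = 0 := by
      change ((LinearMap.ker g).subtype ∘ₗ κ) 1 = 0
      rw [← hc]
      change c • ι 1 = 0
      rw [← map_smul, h1, map_zero]
    exact one_ne_zero (hκ (a₁ := 1) (a₂ := 0) (by rw [map_zero]; exact Subtype.ext h2))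
  have h3 : Module.length R (D →ₗ[R] D) ≤ Module.length R (D →ₗ[R] E) :=
    Module.length_le_of_injective (LinearMap.compRight R (M := D) g) fun a b hab =>
      LinearMap.ext fun x => hg1 (LinearMap.congr_fun hab x)
  rw [hDD, hE.length_hom hDf hkD, hE1, mul_one, ← hEA] at h3
  refine ⟨LinearEquiv.ofBijective g ⟨hg1, ?_⟩⟩
  rw [← LinearMap.range_eq_top]
  by_contra hne
  obtain ⟨_, _⟩ := isFiniteLength_iff_isNoetherian_isArtinian.1 hEf
  have h4 := Submodule.length_lt hne
  rw [← (LinearEquiv.ofInjective g hg1).length_eq] at h4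
  exact absurd h3 (not_le.2 h4)

end ArtinianDuality

section Canonical

open IsLocalRing RingTheory.Sequence

variable {R : Type u} [CommRing R] [IsLocalRing R]

/-- A maximal regular sequence of a Cohen-Macaulay local ring. -/
structure MaxReg (R : Type u) [CommRing R] [IsLocalRing R] (rs : List R) : Prop where
  mem : ∀ r ∈ rs, r ∈ maximalIdeal R
  reg : IsWeaklyRegular R rs
  dim : ringKrullDim (R ⧸ Ideal.ofList rs) ≤ 0

variable [IsNoetherianRing R]

lemma exists_maxReg (hR : (ldepth R R : WithBot ℕ∞) = ringKrullDim R) :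
    ∃ rs : List R, MaxReg R rs ∧ ldepth R R = rs.length := by
  have h1 : ldepth R R ≠ ⊤ := by
    intro h
    rw [h] at hR
    exact (ringKrullDim_ne_top (R := R)) hR.symm
  obtain ⟨n, hn⟩ := ENat.ne_top_iff_exists.1 h1
  obtain ⟨rs, rfl, hm, hr⟩ := le_ldepth_iff_exists.1 hn.le
  refine ⟨rs, ⟨hm, hr.toIsWeaklyRegular, ?_⟩, hn.symm⟩
  have h2 := ringKrullDim_add_length_eq_ringKrullDim_of_isRegular rs hr
  rw [← hR, ← hn] at h2
  generalize ringKrullDim (R ⧸ Ideal.ofList rs) = d at *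
  cases d with
  | bot => exact bot_le
  | coe d =>
    have h3 : d + (rs.length : ℕ∞) = rs.length := by exact_mod_cast h2
    have h4 : d = 0 := by
      cases d with
      | top => simp at h3
      | coe d => norm_cast at h3 ⊢; omega
    rw [h4]; rfl

variable {rs : List R} {C D : Type u} [AddCommGroup C] [Module R C] [AddCommGroup D] [Module R D]

omit [IsNoetherianRing R] in
lemma MaxReg.kills_residue (h : MaxReg R rs) : Kills rs (R ⧸ maximalIdeal R) := by
  intro r hr y
  obtain ⟨y, rfl⟩ := Ideal.Quotient.mk_surjective y
  exact Ideal.Quotient.eq_zero_iff_mem.2 (Ideal.mul_mem_right _ _ (h.mem r hr))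

/-- The homothety isomorphism of a semidualizing module. -/
def Semi.equiv (hC : Semi R C) : R ≃ₗ[R] (C →ₗ[R] C) := LinearEquiv.ofBijective _ hC.bij

omit [IsLocalRing R] in
lemma Semi.isWeaklyRegular (hC : Semi R C) (h : IsWeaklyRegular R rs) : IsWeaklyRegular C rs := by
  have := hC.fin
  exact isWeaklyRegular_of_hom hC.bij.1 rs (ModuleCat.of R C) hC.ev
    ((LinearEquiv.isWeaklyRegular_congr hC.equiv rs).1 h)

omit [IsLocalRing R] in
lemma Semi.exists_quo_equiv (hC : Semi R C) (h : IsWeaklyRegular R rs) :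
    Nonempty (Quo rs (ModuleCat.of R R) ≃ₗ[R] (C →ₗ[R] Quo rs (ModuleCat.of R C))) := by
  obtain ⟨e⟩ := exists_quo_hom_equiv rs (ModuleCat.of R C) hC.ev (hC.isWeaklyRegular h)
  exact ⟨(Quo.congr rs (M := ModuleCat.of R R) (N := ModuleCat.of R (C →ₗ[R] C)) hC.equiv).trans e⟩

omit [IsLocalRing R] in
lemma Semi.length_end_quo (hC : Semi R C) (h : IsWeaklyRegular R rs) :
    Module.length R (Quo rs (ModuleCat.of R C) →ₗ[R] Quo rs (ModuleCat.of R C)) =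
      Module.length R (Quo rs (ModuleCat.of R R)) := by
  obtain ⟨e⟩ := hC.exists_quo_equiv h
  rw [e.length_eq]
  exact (LinearEquiv.ofBijective _ (Quo.lcomp_mk_bijective rs (ModuleCat.of R C)
    (Quo.kills rs _))).length_eq

/-- The Bass number of a Cohen-Macaulay local ring at its depth, in terms of a semidualizing
module. -/
lemma Semi.length_ext (hC : Semi R C) (h : MaxReg R rs) :
    Module.length R (ExtGrp R (R ⧸ maximalIdeal R) R rs.length) =
      Module.length R ((R ⧸ maximalIdeal R) ⊗[R] C) *
        Module.length R ((R ⧸ maximalIdeal R) →ₗ[R] Quo rs (ModuleCat.of R C)) := by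
  have := hC.fin
  obtain ⟨e₁⟩ := exists_ext_equiv_hom_quo rs (ModuleCat.of R R) h.kills_residue h.reg
  obtain ⟨e₂⟩ := hC.exists_quo_equiv h.reg
  rw [(extGrpEquiv _ _ _).length_eq]
  refine (e₁.trans ((e₂.congrRight).trans (TensorProduct.lift.equiv (.id R) _ _ _))).length_eq.trans
    (length_hom_of_residue fun r hr v => ?_)
  induction v with
  | zero => exact smul_zero _
  | add x y hx hy => rw [smul_add, hx, hy, add_zero]
  | tmul x y =>
    obtain ⟨x, rfl⟩ := Ideal.Quotient.mk_surjective x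
    rw [TensorProduct.smul_tmul']
    have : r • Ideal.Quotient.mk (maximalIdeal R) x = 0 :=
      Ideal.Quotient.eq_zero_iff_mem.2 (Ideal.mul_mem_right _ _ hr)
    rw [this, TensorProduct.zero_tmul]

lemma MaxReg.ev (h : MaxReg R rs) [Module.Finite R C] {n : ℕ}
    (hn : ∀ (L : ModuleCat.{u} R) i, n < i → EV R L C i) (L : Type u)
    [AddCommGroup L] [Module R L] [Module.Finite R L] (i : ℕ) (hi : rs.length < i) :
    EV R L C i := by
  have := Quo.finite rs (ModuleCat.of R R)
  have := nontrivial_quo rs h.mem (ModuleCat.of R R)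
  obtain ⟨ι, hι⟩ := exists_residue_injective (isFiniteLength_of_kills h.dim
    (Quo.kills rs (ModuleCat.of R R)))
  refine ev_of_residue_injective hn ι hι (fun i hi => ?_) L i hi
  refine ev_quo rs (ModuleCat.of R R) 0 (fun j hj => ?_) h.reg i (by omega)
  obtain ⟨j, rfl⟩ : ∃ j', j = j' + 1 := ⟨j - 1, by omega⟩
  exact ev_projective j

lemma MaxReg.relInjective (h : MaxReg R rs) (hC : Semi R C) {n : ℕ}
    (hn : ∀ (L : ModuleCat.{u} R) i, n < i → EV R L C i) :
    RelInjective rs (Quo rs (ModuleCat.of R C)) := fun _ _ _ ι hι hL φ =>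
  have := hC.fin
  extend_of_kills_of_ev ι hι rs (ModuleCat.of R C) hL (hC.isWeaklyRegular h.reg)
    (h.ev hn _ _ (Nat.lt_succ_self _)) φ

lemma MaxReg.length_hom_residue (h : MaxReg R rs) (hC : Semi R C) {n : ℕ}
    (hn : ∀ (L : ModuleCat.{u} R) i, n < i → EV R L C i) :
    Module.length R ((R ⧸ maximalIdeal R) →ₗ[R] Quo rs (ModuleCat.of R C)) = 1 :=
  have := hC.fin
  have := Quo.finite rs (ModuleCat.of R C)
  ((h.relInjective hC hn).length_hom_residue h.dim h.mem (Quo.kills _ _)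
    (hC.length_end_quo h.reg)).1

/-- A semidualizing module of type one over a Cohen-Macaulay local ring is isomorphic to the
canonical module. -/
lemma MaxReg.exists_equiv (h : MaxReg R rs) (hC : Semi R C) {n : ℕ}
    (hn : ∀ (L : ModuleCat.{u} R) i, n < i → EV R L C i) (hD : Semi R D)
    (hD1 : Module.length R ((R ⧸ maximalIdeal R) →ₗ[R] Quo rs (ModuleCat.of R D)) = 1) :
    Nonempty (D ≃ₗ[R] C) := by
  have := hC.fin
  have := hD.fin
  have := Quo.finite rs (ModuleCat.of R C)
  have := Quo.finite rs (ModuleCat.of R D)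
  obtain ⟨e⟩ := (h.relInjective hC hn).exists_equiv h.dim h.mem (Quo.kills _ _)
    (hC.length_end_quo h.reg) (Quo.kills rs (ModuleCat.of R D)) (hD.length_end_quo h.reg) hD1
  have hDr := hD.isWeaklyRegular h.reg
  obtain ⟨f, hf⟩ := exists_lift_quo rs (ModuleCat.of R C) (fun i =>
    ev_of_isWeaklyRegular (k := rs.length) (fun L hL i hi => h.ev hn L i hi) rs h.mem
      (ModuleCat.of R D) hDr (i + 1) (by omega)) (hC.isWeaklyRegular h.reg)
    (e.toLinearMap ∘ₗ Quo.mk rs (ModuleCat.of R D))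
  have hq : Quo.map rs (M := ModuleCat.of R D) (N := ModuleCat.of R C) f = e.toLinearMap := by
    ext x
    obtain ⟨x, rfl⟩ := Quo.mk_surjective rs _ x
    rw [Quo.map_mk]
    exact LinearMap.congr_fun hf x
  refine ⟨LinearEquiv.ofBijective f ⟨?_, ?_⟩⟩
  · exact injective_of_quo_map rs h.mem (X := ModuleCat.of R D) (Y := ModuleCat.of R C) f
      (hC.isWeaklyRegular h.reg) (by rw [hq]; exact e.injective)
  · exact surjective_of_quo_map rs h.mem (X := ModuleCat.of R D) (Y := ModuleCat.of R C) f
      (by rw [hq]; exact e.surjective)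

end Canonical

section Identify

open IsLocalRing

variable {R : Type u} [CommRing R]

lemma length_eq_card {V k : Type u} [AddCommGroup V] [CommRing k] [Algebra R k] [Module R V]
    {ι : Type u} (hk : Module.length R k = 1) (e : V ≃ₗ[R] (ι →₀ k)) :
    Module.length R V = ENat.card ι := by
  rw [e.length_eq, Module.length_finsupp, hk, mul_one]

variable [IsLocalRing R]

lemma length_residue : Module.length R (R ⧸ maximalIdeal R) = 1 := by
  have : IsSimpleModule R (R ⧸ maximalIdeal R) :=
    isSimpleModule_iff_isCoatom.2 (maximalIdeal.isMaximal R).out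
  exact Module.length_eq_one R _

lemma eq_one_of_mul_eq_self {n m : ℕ∞} (h0 : n ≠ 0) (h1 : n ≠ ⊤) (h : n * m = n) : m = 1 := by
  lift n to ℕ using h1
  cases m with
  | top => simp [ENat.mul_top h0] at h
  | coe m =>
    norm_cast at h h0 ⊢
    exact Nat.eq_of_mul_eq_mul_left (Nat.pos_of_ne_zero h0) (by omega)

variable {ω : Type u} [AddCommGroup ω] [Module R ω] {a : Ideal R}

lemma le_maximalIdeal_of_isLocalRing_quotient [IsLocalRing (R ⧸ a)] : a ≤ maximalIdeal R :=
  le_maximalIdeal fun h =>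
    not_subsingleton (R ⧸ a) (Ideal.Quotient.subsingleton_iff.2 h)

lemma map_mk_maximalIdeal [IsLocalRing (R ⧸ a)] :
    Ideal.map (Ideal.Quotient.mk a) (maximalIdeal R) = maximalIdeal (R ⧸ a) :=
  eq_maximalIdeal (Ideal.IsMaximal.map_of_surjective_of_ker_le Ideal.Quotient.mk_surjective
    (by rw [Ideal.mk_ker]; exact le_maximalIdeal_of_isLocalRing_quotient))

lemma length_residue_tensor_baseChange [IsLocalRing (R ⧸ a)] :
    Module.length (R ⧸ a) (((R ⧸ a) ⧸ maximalIdeal (R ⧸ a)) ⊗[R ⧸ a] ((R ⧸ a) ⊗[R] ω)) =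
      Module.length R ((R ⧸ maximalIdeal R) ⊗[R] ω) := by
  have e : ((R ⧸ a) ⧸ maximalIdeal (R ⧸ a)) ≃ₗ[R] R ⧸ maximalIdeal R := by
    rw [← map_mk_maximalIdeal]
    exact (DoubleQuot.quotQuotEquivQuotOfLEₐ R
      le_maximalIdeal_of_isLocalRing_quotient).toLinearEquiv
  rw [(AlgebraTensorModule.cancelBaseChange R (R ⧸ a) (R ⧸ a)
    ((R ⧸ a) ⧸ maximalIdeal (R ⧸ a)) ω).length_eq,
    ← Module.length_eq_of_surjective (S := R) Ideal.Quotient.mk_surjective]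
  exact (TensorProduct.congr e (LinearEquiv.refl R ω)).length_eq

lemma length_residue_tensor_ne_zero [Module.Finite R ω] [Nontrivial ω] :
    Module.length R ((R ⧸ maximalIdeal R) ⊗[R] ω) ≠ 0 := by
  rw [Ne, Module.length_eq_zero_iff]
  intro h
  exact not_subsingleton ω ((subsingleton_tensorProduct (R := R) (M := ω)).1 h)

lemma length_residue_tensor_ne_top [Module.Finite R ω] :
    Module.length R ((R ⧸ maximalIdeal R) ⊗[R] ω) ≠ ⊤ := by
  change Module.length R (ResidueField R ⊗[R] ω) ≠ ⊤
  rw [Module.length_eq_of_surjective (R := ResidueField R) residue_surjective]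
  exact Module.length_ne_top

lemma length_ext_eq [IsLocalRing (R ⧸ a)] (haQG : IsQuasiGorensteinIdeal R a) {n n' : ℕ}
    (hn : ldepth R R = n) (hn' : ldepth (R ⧸ a) (R ⧸ a) = n') :
    Module.length R (ExtGrp R (R ⧸ maximalIdeal R) R n) =
      Module.length (R ⧸ a) (ExtGrp (R ⧸ a) ((R ⧸ a) ⧸ maximalIdeal (R ⧸ a)) (R ⧸ a) n') := by
  have h := haQG.2 0
  rw [map_mk_maximalIdeal, zero_add, zero_add] at h
  change BassNumbersEq R _ _ (R ⧸ a) _ (ldepth (R ⧸ a) (R ⧸ a)).toNat at h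
  rw [hn, hn', ENat.toNat_natCast, ENat.toNat_natCast] at h
  obtain ⟨ι, ⟨e₁⟩, ⟨e₂⟩⟩ := h
  exact (length_eq_card (R := R) length_residue e₁).trans
    (length_eq_card (R := R ⧸ a) length_residue e₂).symm

variable [IsNoetherianRing R]

/-- The canonical module of the quotient by a Cohen-Macaulay quasi-Gorenstein ideal is the base
change of the canonical module. -/
lemma exists_canonical_equiv (hCM : (ldepth R R : WithBot ℕ∞) = ringKrullDim R)
    (hω : IsCanonicalModule R ω) [IsLocalRing (R ⧸ a)]
    (haCM : (ldepth (R ⧸ a) (R ⧸ a) : WithBot ℕ∞) = ringKrullDim (R ⧸ a))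
    (haQG : IsQuasiGorensteinIdeal R a) {ω' : Type u} [AddCommGroup ω'] [Module (R ⧸ a) ω']
    (hω' : IsCanonicalModule (R ⧸ a) ω') :
    Nonempty (((R ⧸ a) ⊗[R] ω) ≃ₗ[R ⧸ a] ω') := by
  have hC := hω.1.toSemi
  have := hC.fin
  obtain ⟨rs, h, hrs⟩ := exists_maxReg hCM
  obtain ⟨zs, h', hzs⟩ := exists_maxReg haCM
  have hW : Semi (R ⧸ a) ((R ⧸ a) ⊗[R] ω) :=
    hC.baseChange (stdSyz R ω) (haQG.1.aus (stdSyz R ω) hω)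
  obtain ⟨n, hn⟩ := hω.2.exists_ev
  obtain ⟨n', hn'⟩ := hω'.2.exists_ev
  refine h'.exists_equiv hω'.1.toSemi hn' hW ?_
  have : Nontrivial ω := by
    by_contra h
    rw [not_nontrivial_iff_subsingleton] at h
    have : Subsingleton (ω →ₗ[R] ω) := inferInstance
    exact not_subsingleton R hC.bij.1.subsingleton
  have h1 := hC.length_ext h
  rw [h.length_hom_residue hC hn, mul_one] at h1
  have h2 := hW.length_ext h'
  rw [length_residue_tensor_baseChange] at h2
  exact eq_one_of_mul_eq_self (length_residue_tensor_ne_zero (R := R) (ω := ω))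
    length_residue_tensor_ne_top
    (h2.symm.trans ((length_ext_eq haQG hrs hzs).symm.trans h1))

end Identify

section Dimension

open IsLocalRing RingTheory.Sequence

variable {R : Type u} [CommRing R] [IsLocalRing R] [IsNoetherianRing R]
  {M N : Type u} [AddCommGroup M] [Module R M] [AddCommGroup N] [Module R N]

omit [IsLocalRing R] [IsNoetherianRing R] in
lemma quotSMulTop_map_subtype_injective {X : Type u} [AddCommGroup X] [Module R X] (I : Ideal R)
    {x : R} (hx : IsSMulRegular X x) : Function.Injective
      (QuotSMulTop.map x (Submodule.torsionBySet R X (I : Set R)).subtype) := by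
  rw [← LinearMap.ker_eq_bot, eq_bot_iff]
  intro v hv
  obtain ⟨v, rfl⟩ := Submodule.Quotient.mk_surjective _ v
  have h1 : (v : X) ∈ x • (⊤ : Submodule R X) := by
    rw [← Submodule.Quotient.mk_eq_zero]
    exact hv
  obtain ⟨w, -, hw⟩ := h1
  change x • w = (v : X) at hw
  rw [Submodule.mem_bot, Submodule.Quotient.mk_eq_zero]
  refine ⟨⟨w, ?_⟩, trivial, Subtype.ext hw⟩
  rw [Submodule.mem_torsionBySet_iff]
  intro a
  refine hx ?_
  change x • (a : R) • w = x • (0 : X)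
  rw [smul_comm, hw, smul_zero]
  exact (Submodule.mem_torsionBySet_iff _ _).1 v.2 a

/-- The dimension of a nonzero submodule is at least the length of every regular sequence on the
ambient module. -/
lemma length_le_supportDim : ∀ (rs : List R) (_ : ∀ r ∈ rs, r ∈ maximalIdeal R)
    (X : ModuleCat.{u} R) [Module.Finite R X], IsWeaklyRegular X rs →
    ∀ (M : ModuleCat.{u} R) [Module.Finite R M] [Nontrivial M] (f : M →ₗ[R] X),
      Function.Injective f → (rs.length : WithBot ℕ∞) ≤ Module.supportDim R M
  | [], _, X, _, _, M, _, _, _, _ => by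
    have h := Module.supportDim_ne_bot_of_nontrivial R M
    change ((0 : ℕ) : WithBot ℕ∞) ≤ _
    generalize Module.supportDim R M = d at *
    cases d with
    | bot => exact absurd rfl h
    | coe d => exact_mod_cast zero_le
  | x :: rs, hrs, X, _, hX, M, _, _, f, hf => by
    rw [isWeaklyRegular_cons_iff] at hX
    let N := Submodule.torsionBySet R X (Module.annihilator R M : Set R)
    have hN : LinearMap.range f ≤ N := by
      rintro _ ⟨v, rfl⟩
      refine (Submodule.mem_torsionBySet_iff _ _).2 fun a => ?_
      rw [← map_smul, Module.mem_annihilator.1 a.2, map_zero]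
    have : Nontrivial N := (Function.Injective.nontrivial
      (f := f.codRestrict N fun v => hN ⟨v, rfl⟩) fun v w h => hf (congrArg Subtype.val h))
    have hx : x ∈ maximalIdeal R := hrs x (by simp)
    have : Nontrivial (QuotSMulTop x N) := nontrivial_quotSMulTop_of_mem_maximalIdeal N hx
    have ih := length_le_supportDim rs (fun r hr => hrs r (List.mem_cons_of_mem _ hr))
      (ModuleCat.of R (QuotSMulTop x X)) hX.2 (ModuleCat.of R (QuotSMulTop x N)) _
      (quotSMulTop_map_subtype_injective _ hX.1)
    have h1 : Module.supportDim R (QuotSMulTop x N) + 1 = Module.supportDim R N :=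
      Module.supportDim_quotSMulTop_succ_eq_supportDim (fun v w h => Subtype.ext
        (hX.1 (congrArg Subtype.val h))) hx
    have h2 : Module.supportDim R N ≤ Module.supportDim R M := by
      rw [Module.supportDim_eq_ringKrullDim_quotient_annihilator,
        Module.supportDim_eq_ringKrullDim_quotient_annihilator]
      refine ringKrullDim_le_of_surjective (Ideal.Quotient.factor fun r hr => ?_)
        (Ideal.Quotient.factor_surjective _)
      refine Module.mem_annihilator.2 fun v => Subtype.ext ?_
      exact (Submodule.mem_torsionBySet_iff _ _).1 v.2 ⟨r, hr⟩
    refine le_trans ?_ h2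
    rw [← h1, List.length_cons]
    push_cast
    gcongr

omit [IsNoetherianRing R] in
lemma _root_.Paper.IsCMModule.nontrivial (h : IsCMModule R M) : Nontrivial M := by
  by_contra hM
  rw [not_nontrivial_iff_subsingleton] at hM
  unfold IsCMModule moduleDim at h
  rw [Module.annihilator_eq_top_iff.2 hM] at h
  have : Subsingleton (R ⧸ (⊤ : Ideal R)) := Ideal.Quotient.subsingleton_iff.2 rfl
  rw [ringKrullDim_eq_bot_of_subsingleton] at h
  exact WithBot.coe_ne_bot h

lemma _root_.Paper.IsCMModule.exists_isWeaklyRegular [Module.Finite R M] (h : IsCMModule R M)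
    {X : Type u} [AddCommGroup X] [Module R X] [Module.Finite R X] {zs : List R}
    (hm : ∀ z ∈ zs, z ∈ maximalIdeal R) (hz : IsWeaklyRegular X zs) (f : M →ₗ[R] X)
    (hf : Function.Injective f) :
    ∃ rs : List R, rs.length = zs.length ∧ (∀ r ∈ rs, r ∈ maximalIdeal R) ∧
      IsWeaklyRegular M rs := by
  have := h.nontrivial
  have h1 := length_le_supportDim zs hm (ModuleCat.of R X) hz (ModuleCat.of R M) f hf
  change _ ≤ Module.supportDim R M at h1
  rw [Module.supportDim_eq_ringKrullDim_quotient_annihilator] at h1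
  change _ ≤ moduleDim R M at h1
  rw [← h] at h1
  have h2 : (zs.length : ℕ∞) ≤ ldepth R M := by exact_mod_cast h1
  obtain ⟨rs, h3, h4, h5⟩ := le_ldepth_iff_exists.1 h2
  exact ⟨rs, h3, h4, h5.toIsWeaklyRegular⟩

lemma _root_.Paper.IsCMModule.of_iff [Module.Finite R M] [Module.Finite R N] [Nontrivial N]
    (h : IsCMModule R M) (ha : Module.annihilator R M = Module.annihilator R N)
    (hr : ∀ rs : List R, IsWeaklyRegular M rs ↔ IsWeaklyRegular N rs) : IsCMModule R N := by
  have := h.nontrivial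
  have h1 : ldepth R M = ldepth R N := by
    refine ENat.eq_of_forall_natCast_le_iff fun n => ?_
    rw [le_ldepth_iff_exists, le_ldepth_iff_exists]
    constructor
    · rintro ⟨rs, h1, h2, h3⟩
      exact ⟨rs, h1, h2, IsRegular.of_isWeaklyRegular_of_mem_maximalIdeal N h2
        ((hr rs).1 h3.1)⟩
    · rintro ⟨rs, h1, h2, h3⟩
      exact ⟨rs, h1, h2, IsRegular.of_isWeaklyRegular_of_mem_maximalIdeal M h2
        ((hr rs).2 h3.1)⟩
  unfold IsCMModule moduleDim at h ⊢
  rw [← h1, ← ha, h]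

end Dimension

section Linked

variable {S : Type u} [CommRing S] {C P₁ P₀ : Type u} [AddCommGroup C] [Module S C]
  [AddCommGroup P₁] [Module S P₁] [AddCommGroup P₀] [Module S P₀] (f : P₁ →ₗ[S] P₀)

variable (C) in
/-- The image of `Hom(f, C)`. -/
abbrev dualRange : Submodule S (P₁ →ₗ[S] C) := LinearMap.range (LinearMap.lcomp S C f)

variable (C) in
/-- The map `φ ↦ (c ↦ φ(·) c)` between images of duals. -/
def dualRangeSMul : dualRange S f →ₗ[S] C →ₗ[S] dualRange C f :=
  LinearMap.mk₂ S (fun φ c => ⟨φ.1.smulRight c, by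
      obtain ⟨_, ψ, rfl⟩ := φ
      exact ⟨ψ.smulRight c, rfl⟩⟩)
    (fun φ ψ c => Subtype.ext (LinearMap.ext fun p => add_smul _ _ _))
    (fun r φ c => Subtype.ext (LinearMap.ext fun p => mul_smul _ _ _))
    (fun φ c d => Subtype.ext (LinearMap.ext fun p => smul_add _ _ _))
    (fun r φ c => Subtype.ext (LinearMap.ext fun p => smul_comm _ _ _))

@[simp] lemma dualRangeSMul_apply (φ : dualRange S f) (c : C) (p : P₁) :
    (dualRangeSMul C f φ c).1 p = φ.1 p • c := rfl

lemma dualRangeSMul_injective (hC : Function.Injective (LinearMap.lsmul S C)) :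
    Function.Injective (dualRangeSMul C f) := by
  intro φ ψ h
  refine Subtype.ext (LinearMap.ext fun p => hC (LinearMap.ext fun c => ?_))
  exact LinearMap.congr_fun (congrArg Subtype.val (LinearMap.congr_fun h c)) p

/-- If homomorphisms to the ring extend along `range f → P₀`, then the image of `Hom(f, S)` is
recovered from the image of `Hom(f, C)`. -/
lemma dualRangeSMul_bijective_of_extend (hC : Function.Bijective (LinearMap.lsmul S C))
    (hf : ∀ φ : LinearMap.range f →ₗ[S] S, ∃ ψ : P₀ →ₗ[S] S,
      ψ ∘ₗ (LinearMap.range f).subtype = φ) : Function.Bijective (dualRangeSMul C f) := by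
  refine ⟨dualRangeSMul_injective f hC.1, fun h => ?_⟩
  let e := LinearEquiv.ofBijective _ hC
  let φ : P₁ →ₗ[S] S := e.symm.toLinearMap ∘ₗ ((dualRange C f).subtype ∘ₗ h).flip
  have hφ (p : P₁) (c : C) : φ p • c = (h c).1 p :=
    LinearMap.congr_fun (e.apply_symm_apply (((dualRange C f).subtype ∘ₗ h).flip p)) c
  have hk : LinearMap.ker f ≤ LinearMap.ker φ := by
    intro p hp
    refine hC.1 (LinearMap.ext fun c => (hφ p c).trans ?_)
    obtain ⟨χ, hχ⟩ := (h c).2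
    rw [← hχ]
    change χ (f p) = _
    rw [LinearMap.mem_ker.1 hp]
    simp
  obtain ⟨ψ, hψ⟩ := hf ((LinearMap.ker f).liftQ φ hk ∘ₗ f.quotKerEquivRange.symm.toLinearMap)
  have hψ' : ψ ∘ₗ f = φ := by
    ext p
    refine (LinearMap.congr_fun hψ ⟨f p, LinearMap.mem_range_self f p⟩).trans ?_
    rw [LinearMap.comp_apply, LinearEquiv.coe_coe, LinearMap.quotKerEquivRange_symm_apply_image]
    simp
  refine ⟨⟨φ, ψ, hψ'⟩, LinearMap.ext fun c => Subtype.ext (LinearMap.ext fun p => hφ p c)⟩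

lemma exists_sum_of_mem_dualRange (h0 : Function.Surjective (dualTensorHom S P₀ C))
    (χ : dualRange C f) : ∃ t : dualRange S f ⊗[S] C,
      TensorProduct.lift (dualRangeSMul C f) t = χ := by
  obtain ⟨_, χ, rfl⟩ := χ
  obtain ⟨t, rfl⟩ := h0 χ
  refine ⟨(LinearMap.lcomp S S f).rangeRestrict.rTensor C t, Subtype.ext ?_⟩
  induction t with
  | zero => simp
  | add x y hx hy =>
    rw [map_add, map_add, Submodule.coe_add, hx, hy]
    ext; simp
  | tmul φ c => ext p; simp

end Linked

section Pairing

variable {S : Type u} [CommRing S] {C D E : Type u} [AddCommGroup C] [Module S C]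
  [AddCommGroup D] [Module S D] [AddCommGroup E] [Module S E]

lemma lift_bijective_of_mk_bijective [IsNoetherianRing S] [Module.Finite S C] [Module.Finite S D]
    (hC : Function.Injective (LinearMap.lsmul S C)) (β : D →ₗ[S] C →ₗ[S] E)
    (hβ : Function.Injective β) (hs : Function.Surjective (TensorProduct.lift β))
    (hM : Function.Bijective (TensorProduct.mk S D C)) :
    Function.Bijective (TensorProduct.lift β) := by
  refine ⟨?_, hs⟩
  refine LinearMap.ker_eq_bot.1 (Submodule.subsingleton_iff_eq_bot.1 ?_)
  refine subsingleton_of_hom_subsingleton hC (subsingleton_of_forall_eq 0 fun h => ?_)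
  obtain ⟨φ, hφ⟩ := hM.2 ((LinearMap.ker (TensorProduct.lift β)).subtype ∘ₗ h)
  have h1 : φ = 0 := by
    refine hβ (LinearMap.ext fun c => ?_)
    have h2 := LinearMap.congr_fun hφ c
    change φ ⊗ₜ c = (h c).1 at h2
    have h3 := LinearMap.mem_ker.1 (h c).2
    rw [← h2, TensorProduct.lift.tmul] at h3
    simpa using h3
  subst h1
  ext c
  have h2 := LinearMap.congr_fun hφ c
  rw [map_zero] at h2
  exact h2.symm

lemma subsingleton_of_tensorProduct [IsLocalRing S] [Module.Finite S D] [Module.Finite S C]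
    [Nontrivial C] (h : Subsingleton (D ⊗[S] C)) : Subsingleton D := by
  by_contra hD
  rw [not_subsingleton_iff_nontrivial] at hD
  obtain ⟨N, hN, -⟩ := (eq_top_or_exists_le_coatom (⊥ : Submodule S D)).resolve_left bot_ne_top
  have : IsSimpleModule S (D ⧸ N) := isSimpleModule_iff_isCoatom.2 hN
  obtain ⟨I, hI, ⟨e⟩⟩ := isSimpleModule_iff_quot_maximal.1 this
  obtain rfl := IsLocalRing.eq_maximalIdeal hI
  have h1 : Function.Surjective ((e.toLinearMap ∘ₗ N.mkQ).rTensor C) :=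
    LinearMap.rTensor_surjective C (e.surjective.comp N.mkQ_surjective)
  have h2 := h1.subsingleton
  exact not_subsingleton C ((IsLocalRing.subsingleton_tensorProduct (R := S) (M := C)).1 h2)

lemma bijective_of_evalMap_injective [IsLocalRing S] [IsNoetherianRing S] [Module.Finite S C]
    [Nontrivial C] [Module.Finite S E] (β : D →ₗ[S] C →ₗ[S] E)
    (hβ : Function.Injective β) (hs : Function.Surjective (TensorProduct.lift β))
    (hN : Function.Injective (evalMap S C E)) : Function.Bijective β := by
  refine ⟨hβ, LinearMap.range_eq_top.1 (Submodule.Quotient.subsingleton_iff.1 ?_)⟩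
  refine subsingleton_of_tensorProduct (S := S) (C := C) (subsingleton_of_forall_eq 0 fun x => ?_)
  obtain ⟨x, rfl⟩ := LinearMap.rTensor_surjective C (LinearMap.range β).mkQ_surjective x
  obtain ⟨t, ht⟩ := hs (evalMap S C _ (TensorProduct.comm S _ _ x))
  have h1 : x = β.rTensor C t := by
    refine (TensorProduct.comm S _ _).injective (hN (ht.symm.trans ?_))
    clear ht
    induction t with
    | zero => simp
    | add x y hx hy => simp only [map_add, hx, hy]
    | tmul φ c => simp [evalMap]
  rw [h1, ← LinearMap.comp_apply, ← LinearMap.rTensor_comp, LinearMap.range_mkQ_comp]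
  simp

end Pairing

section LinkedPairing

variable {S : Type u} [CommRing S] {C P₁ P₀ D E : Type u} [AddCommGroup C] [Module S C]
  [AddCommGroup P₁] [Module S P₁] [AddCommGroup P₀] [Module S P₀] [AddCommGroup D] [Module S D]
  [AddCommGroup E] [Module S E] {f : P₁ →ₗ[S] P₀} (eD : D ≃ₗ[S] dualRange S f)
  (eE : E ≃ₗ[S] dualRange C f)

/-- The pairing between modules isomorphic to the images of `Hom(f, S)` and `Hom(f, C)`. -/
def linkPairing : D →ₗ[S] C →ₗ[S] E :=
  (eE.symm.congrRight (R := S) (M := C)).toLinearMap ∘ₗ dualRangeSMul C f ∘ₗ eD.toLinearMap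

lemma linkPairing_apply (d : D) (c : C) :
    linkPairing eD eE d c = eE.symm (dualRangeSMul C f (eD d) c) := rfl

lemma linkPairing_injective (hC : Function.Injective (LinearMap.lsmul S C)) :
    Function.Injective (linkPairing eD eE) :=
  (eE.symm.congrRight (R := S) (M := C)).injective.comp
    ((dualRangeSMul_injective f hC).comp eD.injective)

lemma linkPairing_bijective_of_extend (hC : Function.Bijective (LinearMap.lsmul S C))
    (hf : ∀ φ : LinearMap.range f →ₗ[S] S, ∃ ψ : P₀ →ₗ[S] S,
      ψ ∘ₗ (LinearMap.range f).subtype = φ) : Function.Bijective (linkPairing eD eE) :=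
  (eE.symm.congrRight (R := S) (M := C)).bijective.comp
    ((dualRangeSMul_bijective_of_extend f hC hf).comp eD.bijective)

lemma lift_linkPairing_surjective (h0 : Function.Surjective (dualTensorHom S P₀ C)) :
    Function.Surjective (TensorProduct.lift (linkPairing eD eE)) := by
  intro x
  obtain ⟨t, ht⟩ := exists_sum_of_mem_dualRange f h0 (eE x)
  refine ⟨eD.symm.toLinearMap.rTensor C t, eE.injective (Eq.trans ?_ ht)⟩
  clear ht
  induction t with
  | zero => simp
  | add x y hx hy => simp only [map_add, hx, hy]
  | tmul φ c => simp [linkPairing_apply]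

end LinkedPairing

section Presentations

variable {S : Type u} [CommRing S]

/-- Transport of a minimal presentation along an isomorphism. -/
def _root_.Paper.MinPres.congr {X Y : Type u} [AddCommGroup X] [Module S X] [AddCommGroup Y]
    [Module S Y] (P : MinPres S X) (e : X ≃ₗ[S] Y) : MinPres S Y where
  P₁ := P.P₁
  P₀ := P.P₀
  f := P.f
  g := e.toLinearMap ∘ₗ P.g
  finite₁ := P.finite₁
  finite₀ := P.finite₀
  proj₁ := P.proj₁
  proj₀ := P.proj₀
  surj := e.surjective.comp P.surj
  exact := by rw [LinearEquiv.ker_comp]; exact P.exact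
  min₀ := by rw [LinearEquiv.ker_comp]; exact P.min₀
  min₁ := P.min₁

lemma dualTensorHom_surjective_of_projective [IsLocalRing S] (P C : Type u) [AddCommGroup P]
    [Module S P] [Module.Finite S P] [Module.Projective S P] [AddCommGroup C] [Module S C] :
    Function.Surjective (dualTensorHom S P C) := by
  have : Module.Free S P := Module.free_of_flat_of_isLocalRing
  exact dualTensorHom_bijective_free.2

/-- Homomorphisms to the ring extend along a monomorphism `f` for which `f ⊗ C` is injective with
`Ext`-orthogonal cokernel. -/
lemma SES.exists_extend {K P M C : Type u} [AddCommGroup K] [Module S K] [AddCommGroup P]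
    [Module S P] [AddCommGroup M] [Module S M] [AddCommGroup C] [Module S C] {f : K →ₗ[S] P}
    {g : P →ₗ[S] M} (h : SES f g) (hf : Function.Injective (f.rTensor C))
    (hC : Function.Bijective (LinearMap.lsmul S C)) (hM : EV S (M ⊗[S] C) C 1) (φ : K →ₗ[S] S) :
    ∃ ψ : P →ₗ[S] S, ψ ∘ₗ f = φ := by
  obtain ⟨χ, hχ⟩ := (h.rTensor hf).extend hM (TensorProduct.lift (LinearMap.lsmul S C ∘ₗ φ))
  let e := LinearEquiv.ofBijective _ hC
  refine ⟨e.symm.toLinearMap ∘ₗ TensorProduct.curry χ, LinearMap.ext fun k => e.injective ?_⟩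
  refine (e.apply_symm_apply _).trans (LinearMap.ext fun c => ?_)
  exact LinearMap.congr_fun hχ (k ⊗ₜ c)

end Presentations

section LinkedModules

variable {S : Type u} [CommRing S] {C M N : Type u}
  [AddCommGroup C] [Module S C] [AddCommGroup M] [Module S M] [AddCommGroup N] [Module S N]

lemma exists_equiv_submodule {X : Type u} [AddCommGroup X] [Module S X] (K : Submodule S X) :
    ∃ Q : ModuleCat.{u} S, Nonempty (Q ≃ₗ[S] K) :=
  ⟨ModuleCat.of S K, ⟨LinearEquiv.refl S K⟩⟩

/-- Vanishing of `Tor₁(M, C)`, phrased through presentations of `M` by projective modules. -/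
def TensorExactTo (S : Type u) [CommRing S] (C M : Type u) [AddCommGroup C] [Module S C]
    [AddCommGroup M] [Module S M] : Prop :=
  ∀ (K P : ModuleCat.{u} S) (f : K →ₗ[S] P) (g : P →ₗ[S] M), Module.Projective S P → SES f g →
    Function.Injective (f.rTensor C)

lemma _root_.Paper.MinPres.exists_extend (P : MinPres S M)
    (hC : Function.Bijective (LinearMap.lsmul S C))
    (hT : TensorExactTo S C M) (hE : EV S (M ⊗[S] C) C 1) (φ : LinearMap.range P.f →ₗ[S] S) :
    ∃ ψ : P.P₀ →ₗ[S] S, ψ ∘ₗ (LinearMap.range P.f).subtype = φ := by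
  have h : SES (LinearMap.range P.f).subtype P.g := by
    refine ⟨Subtype.val_injective, P.surj, fun y => ?_⟩
    rw [← LinearMap.mem_ker, ← P.exact]
    exact ⟨fun h => ⟨⟨y, h⟩, rfl⟩, fun ⟨x, hx⟩ => hx ▸ x.2⟩
  exact h.exists_extend (hT (ModuleCat.of S _) (ModuleCat.of S P.P₀) _ _ P.proj₀ h) hC hE φ

variable [IsLocalRing S] [IsNoetherianRing S]

theorem isHorizontallyLinked_tensorProduct [Module.Finite S M] (hC : Semi S C)
    (hM : Function.Bijective (TensorProduct.mk S M C)) (hT : TensorExactTo S C M)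
    (hE : EV S (M ⊗[S] C) C 1) (h : IsHorizontallyLinkedMS S M) :
    IsHorizontallyLinked S C (M ⊗[S] C) := by
  have := hC.fin
  obtain ⟨L, ⟨P, ⟨eL⟩⟩, ⟨F, ⟨eM⟩⟩⟩ := h
  obtain ⟨Q, ⟨eQ⟩⟩ := exists_equiv_submodule (dualRange C P.f)
  obtain ⟨E, ⟨eE⟩⟩ := exists_equiv_submodule (dualRange C F.f)
  have h1 := linkPairing_bijective_of_extend (f := P.f) eL eQ hC.bij
    (P.exists_extend hC.bij hT hE)
  have := F.finite₀
  have := F.proj₀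
  have h2 := lift_bijective_of_mk_bijective hC.bij.1 _
    (linkPairing_injective (f := F.f) eM eE hC.bij.1)
    (lift_linkPairing_surjective (f := F.f) eM eE (dualTensorHom_surjective_of_projective _ C)) hM
  exact ⟨Q, ⟨P.congr (LinearEquiv.ofBijective _ hM), ⟨eQ⟩⟩,
    ⟨F.congr (LinearEquiv.ofBijective _ h1), ⟨(LinearEquiv.ofBijective _ h2).trans eE⟩⟩⟩

theorem isHorizontallyLinkedMS_hom [Module.Finite S N] (hC : Semi S C)
    (hN : Function.Injective (evalMap S C N)) (hT : TensorExactTo S C (C →ₗ[S] N))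
    (hE : EV S ((C →ₗ[S] N) ⊗[S] C) C 1) (h : IsHorizontallyLinked S C N) :
    IsHorizontallyLinkedMS S (C →ₗ[S] N) := by
  have := hC.fin
  have : Nontrivial C := by
    by_contra hc
    rw [not_nontrivial_iff_subsingleton] at hc
    exact zero_ne_one (hC.bij.1 (LinearMap.ext fun c => Subsingleton.elim _ _) : (0 : S) = 1)
  obtain ⟨Q, ⟨P, ⟨eQ⟩⟩, ⟨F, ⟨eN⟩⟩⟩ := h
  obtain ⟨L, ⟨eL⟩⟩ := exists_equiv_submodule (dualRange S P.f)
  obtain ⟨D, ⟨eD⟩⟩ := exists_equiv_submodule (dualRange S F.f)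
  have h1 := linkPairing_bijective_of_extend (f := P.f) eL eQ hC.bij
    (P.exists_extend hC.bij hT hE)
  have := F.finite₀
  have := F.proj₀
  have h2 := bijective_of_evalMap_injective _
    (linkPairing_injective (f := F.f) eD eN hC.bij.1)
    (lift_linkPairing_surjective (f := F.f) eD eN (dualTensorHom_surjective_of_projective _ C)) hN
  exact ⟨L, ⟨P, ⟨eL⟩⟩, ⟨F.congr (LinearEquiv.ofBijective _ h1).symm,
    ⟨(LinearEquiv.ofBijective _ h2).symm.trans eD⟩⟩⟩

end LinkedModules

section Classes

variable {R : Type u} [CommRing R] {ω M N : Type u} [AddCommGroup ω] [Module R ω]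
  [AddCommGroup M] [Module R M] [AddCommGroup N] [Module R N]

/-- The Bass class, phrased with the auxiliary vanishing predicates. -/
structure Bas (s : Syz R ω) (N : Type u) [AddCommGroup N] [Module R N] : Prop where
  bij : Function.Bijective (evalMap R ω N)
  tv : ∀ i, TV s (ω →ₗ[R] N) i
  ev : ∀ i, EV R ω N (i + 1)

lemma forall_pos_iff_succ {p : ℕ → Prop} : (∀ i, 0 < i → p i) ↔ ∀ i, p (i + 1) :=
  ⟨fun h i => h _ i.succ_pos, fun h i hi => by
    obtain ⟨i, rfl⟩ := Nat.exists_eq_succ_of_ne_zero hi.ne'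
    exact h i⟩

lemma memAus_iff : MemAus R ω M ↔ Aus (stdSyz R ω) M := by
  rw [MemAus, forall_pos_iff_succ, forall_pos_iff_succ]
  simp only [subsingleton_extGrp_iff, subsingleton_torGrp_iff (projectiveResolution _)]
  exact ⟨fun h => ⟨h.1, h.2.1, h.2.2⟩, fun h => ⟨h.bij, h.tv, h.ev⟩⟩

lemma memBass_iff : MemBass R ω N ↔ Bas (stdSyz R ω) N := by
  rw [MemBass, forall_pos_iff_succ, forall_pos_iff_succ]
  simp only [subsingleton_extGrp_iff, subsingleton_torGrp_iff (projectiveResolution _)]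
  exact ⟨fun h => ⟨h.1, h.2.1, h.2.2⟩, fun h => ⟨h.bij, h.tv, h.ev⟩⟩

lemma evalMap_naturality (f : M →ₗ[R] N) (t : ω ⊗[R] (ω →ₗ[R] M)) :
    evalMap R ω N ((LinearMap.llcomp R ω M N f).lTensor ω t) = f (evalMap R ω M t) := by
  induction t with
  | zero => simp
  | add x y hx hy => simp only [map_add, hx, hy]
  | tmul w φ => simp [evalMap]

variable {s : Syz R ω}

lemma Bas.congr (e : M ≃ₗ[R] N) (h : Bas s M) : Bas s N where
  bij := by
    have h1 : evalMap R ω N ∘ (e.congrRight (R := R) (M := ω)).lTensor ω = e ∘ evalMap R ω M :=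
      funext fun t => evalMap_naturality e.toLinearMap t
    refine ((Function.Bijective.of_comp_iff _
      ((e.congrRight (R := R) (M := ω)).lTensor ω).bijective).1 ?_)
    rw [h1]
    exact e.bijective.comp h.bij
  tv i := (h.tv i).congr (e.congrRight (R := R) (M := ω))
  ev i := (h.ev i).congr_right e

/-- Tensoring with `ω` maps the Auslander class to the Bass class. -/
lemma Aus.bas (h : Aus s M) : Bas s (M ⊗[R] ω) where
  bij := by
    let e := LinearEquiv.ofBijective _ h.bij
    have h1 : evalMap R ω (M ⊗[R] ω) ∘ ((TensorProduct.comm R M ω).trans (e.lTensor ω)) = id := by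
      funext t
      induction t with
      | zero => simp
      | add x y hx hy => simpa using congrArg₂ (· + ·) hx hy
      | tmul m w => rfl
    refine ((Function.Bijective.of_comp_iff _
      ((TensorProduct.comm R M ω).trans (e.lTensor ω)).bijective).1 ?_)
    rw [h1]
    exact Function.bijective_id
  tv i := (h.tv i).congr (LinearEquiv.ofBijective _ h.bij)
  ev := h.ev

/-- The evaluation isomorphism for a module in the Bass class. -/
def Bas.equiv (h : Bas s N) : (ω →ₗ[R] N) ⊗[R] ω ≃ₗ[R] N :=
  (TensorProduct.comm R _ _).trans (LinearEquiv.ofBijective _ h.bij)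

/-- `Hom(ω, -)` maps the Bass class to the Auslander class. -/
lemma Bas.aus (h : Bas s N) : Aus s (ω →ₗ[R] N) where
  bij := by
    have h1 : (h.equiv.congrRight (R := R) (M := ω)) ∘ TensorProduct.mk R (ω →ₗ[R] N) ω = id := by
      funext φ
      ext w
      rfl
    refine ((Function.Bijective.of_comp_iff' (h.equiv.congrRight (R := R) (M := ω)).bijective
      _).1 ?_)
    rw [h1]
    exact Function.bijective_id
  tv := h.tv
  ev i := (h.ev i).congr_right h.equiv.symm

end Classes

section BaseChange

variable {R S : Type u} [CommRing R] [CommRing S] [Algebra R S] {ω ω' : Type u} [AddCommGroup ω]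
  [Module R ω] [AddCommGroup ω'] [Module S ω'] (e : (S ⊗[R] ω) ≃ₗ[S] ω')
  {M N : Type u} [AddCommGroup M] [Module R M] [Module S M] [IsScalarTower R S M]
  [AddCommGroup N] [Module R N] [Module S N] [IsScalarTower R S N]

variable (M) in
/-- Tensoring over `S` with `S ⊗ ω` is tensoring over `R` with `ω`. -/
def tensorChange : M ⊗[R] ω ≃ₗ[S] M ⊗[S] ω' :=
  (AlgebraTensorModule.cancelBaseChange R S S M ω).symm.trans (e.lTensor M)

variable (N) in
/-- Homomorphisms over `S` from `S ⊗ ω` are homomorphisms over `R` from `ω`. -/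
def homChange : (ω' →ₗ[S] N) ≃ₗ[S] (ω →ₗ[R] N) :=
  (LinearEquiv.congrLeft N S e.symm).trans (LinearMap.liftBaseChangeEquiv S).symm

include e in
lemma mk_bijective_change (h : Function.Bijective (TensorProduct.mk R M ω)) :
    Function.Bijective (TensorProduct.mk S M ω') := by
  let T := (tensorChange e M).restrictScalars R
  have h1 : homChange e (M ⊗[S] ω') ∘ TensorProduct.mk S M ω' =
      (T.congrRight (R := R) (M := ω)) ∘ TensorProduct.mk R M ω := rfl
  refine ((Function.Bijective.of_comp_iff' (homChange e (M ⊗[S] ω')).bijective _).1 ?_)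
  rw [h1]
  exact (T.congrRight (R := R) (M := ω)).bijective.comp h

include e in
lemma evalMap_bijective_change (h : Function.Bijective (evalMap R ω N)) :
    Function.Bijective (evalMap S ω' N) := by
  let T := tensorChange e (ω' →ₗ[S] N)
  let H := (homChange e N).restrictScalars R
  have h1 : evalMap S ω' N ∘ (TensorProduct.comm S (ω' →ₗ[S] N) ω') ∘ T =
      evalMap R ω N ∘ ((H.rTensor ω).trans (TensorProduct.comm R (ω →ₗ[R] N) ω)) := by
    funext t
    induction t with
    | zero => simp
    | add x y hx hy => simpa using congrArg₂ (· + ·) hx hy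
    | tmul φ w => rfl
  have h2 : Function.Bijective (evalMap S ω' N ∘ (TensorProduct.comm S (ω' →ₗ[S] N) ω') ∘ T) := by
    rw [h1]
    exact h.comp ((H.rTensor ω).trans (TensorProduct.comm R (ω →ₗ[R] N) ω)).bijective
  exact (Function.Bijective.of_comp_iff _
    ((TensorProduct.comm S (ω' →ₗ[S] N) ω').bijective.comp T.bijective)).1 h2

include e in
lemma TV.tensorExactTo {s : Syz R ω} (h : TV s M 0) : TensorExactTo S ω' M := by
  intro K P f g _ hfg
  let _ : Module R K := Module.compHom K (algebraMap R S)
  let _ : Module R P := Module.compHom P (algebraMap R S)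
  have : IsScalarTower R S K := .of_algebraMap_smul fun _ _ => rfl
  have : IsScalarTower R S P := .of_algebraMap_smul fun _ _ => rfl
  have h1 : SES (f.restrictScalars R) (g.restrictScalars R) := ⟨hfg.inj, hfg.surj, hfg.exact⟩
  have h2 := h.rTensor_injective s h1
  have h3 : f.rTensor ω' ∘ tensorChange e K =
      tensorChange e P ∘ (f.restrictScalars R).rTensor ω := by
    funext t
    induction t with
    | zero => simp
    | add x y hx hy => simpa using congrArg₂ (· + ·) hx hy
    | tmul φ w => rfl
  have h4 : Function.Injective (f.rTensor ω' ∘ tensorChange e K) := by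
    rw [h3]
    exact (tensorChange e P).injective.comp h2
  exact (Function.Injective.of_comp_iff' _ (tensorChange e K).bijective).1 h4

end BaseChange

section CohenMacaulay

open IsLocalRing RingTheory.Sequence

variable {R : Type u} [CommRing R] [IsNoetherianRing R] [IsLocalRing R] {a : Ideal R}
  [IsLocalRing (R ⧸ a)] {M N : Type u} [AddCommGroup M] [Module R M] [Module (R ⧸ a) M]
  [IsScalarTower R (R ⧸ a) M] [AddCommGroup N] [Module R N] [Module (R ⧸ a) N]
  [IsScalarTower R (R ⧸ a) N]

omit [IsNoetherianRing R] in
lemma mk_mem_maximalIdeal_iff {r : R} :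
    Ideal.Quotient.mk a r ∈ maximalIdeal (R ⧸ a) ↔ r ∈ maximalIdeal R := by
  refine ⟨fun h hr => h (hr.map _), fun h => ?_⟩
  rw [← map_mk_maximalIdeal]
  exact Ideal.mem_map_of_mem _ h

/-- A Cohen-Macaulay module of the form `Ω_C Tr_C X` over `R ⧸ a` has depth at least the length of
every sequence that is regular on `C`. -/
lemma _root_.Paper.IsCMModule.exists_isWeaklyRegular_of_isOmegaTrC [Module.Finite R M]
    (hM : IsCMModule R M) {C X : Type u} [AddCommGroup C] [Module (R ⧸ a) C]
    [Module.Finite (R ⧸ a) C] [AddCommGroup X] [Module (R ⧸ a) X] {zs : List (R ⧸ a)}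
    (hm : ∀ z ∈ zs, z ∈ maximalIdeal (R ⧸ a)) (hz : IsWeaklyRegular C zs)
    (h : IsOmegaTrC (R ⧸ a) C X M) :
    ∃ rs : List R, rs.length = zs.length ∧ (∀ r ∈ rs, r ∈ maximalIdeal R) ∧
      IsWeaklyRegular M rs := by
  obtain ⟨P, ⟨e⟩⟩ := h
  obtain ⟨ys, rfl⟩ := List.map_surjective_iff.2 (Ideal.Quotient.mk_surjective (I := a)) zs
  have := P.finite₁
  have := P.proj₁
  have h1 : IsWeaklyRegular (P.P₁ →ₗ[R ⧸ a] C) (ys.map (Ideal.Quotient.mk a)) :=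
    isWeaklyRegular_hom _ (ModuleCat.of (R ⧸ a) C) (fun i => ev_projective i) hz
  let _ : Module R (P.P₁ →ₗ[R ⧸ a] C) := Module.compHom _ (algebraMap R (R ⧸ a))
  have : IsScalarTower R (R ⧸ a) (P.P₁ →ₗ[R ⧸ a] C) := .of_algebraMap_smul fun _ _ => rfl
  have : Module.Finite R (P.P₁ →ₗ[R ⧸ a] C) := Module.Finite.trans (R ⧸ a) _
  have h2 := (isWeaklyRegular_map_algebraMap_iff (R ⧸ a) (P.P₁ →ₗ[R ⧸ a] C) ys).1 h1
  obtain ⟨rs, h3, h4, h5⟩ := hM.exists_isWeaklyRegular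
    (fun y hy => mk_mem_maximalIdeal_iff.1 (hm _ (List.mem_map_of_mem hy))) h2
    (((LinearMap.range (P.homC C)).subtype ∘ₗ e.toLinearMap).restrictScalars R)
    ((Submodule.subtype_injective _).comp e.injective)
  exact ⟨rs, by rw [h3, List.length_map], h4, h5⟩

/-- `Ext` into a module of finite injective dimension vanishes on modules of maximal depth. -/
lemma MaxReg.ev_one_of_isWeaklyRegular {zs : List (R ⧸ a)} (hzs : MaxReg (R ⧸ a) zs)
    {C : Type u} [AddCommGroup C] [Module (R ⧸ a) C] [Module.Finite (R ⧸ a) C] {n : ℕ}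
    (hn : ∀ (L : ModuleCat.{u} (R ⧸ a)) i, n < i → EV (R ⧸ a) L C i) [Module.Finite R M]
    {rs : List R} (hl : rs.length = zs.length) (hrs : ∀ r ∈ rs, r ∈ maximalIdeal R)
    (h : IsWeaklyRegular M rs) : EV (R ⧸ a) M C 1 := by
  have : Module.Finite (R ⧸ a) M := Module.Finite.of_restrictScalars_finite R _ _
  refine ev_of_isWeaklyRegular (k := zs.length) (fun L _ i hi => hzs.ev hn L i hi)
    (rs.map (Ideal.Quotient.mk a)) (fun r hr => ?_) (ModuleCat.of (R ⧸ a) M)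
    ((isWeaklyRegular_map_algebraMap_iff (R ⧸ a) M rs).2 h) 1 (by rw [List.length_map]; omega)
  obtain ⟨y, hy, rfl⟩ := List.mem_map.1 hr
  exact mk_mem_maximalIdeal_iff.2 (hrs y hy)

end CohenMacaulay

section Foxby

open RingTheory.Sequence

variable {R : Type u} [CommRing R] {ω M N : Type u} [AddCommGroup ω] [Module R ω]
  [AddCommGroup M] [Module R M] [AddCommGroup N] [Module R N]

variable (R ω M N) in
/-- `M` and `N` correspond to each other under Foxby equivalence with respect to `ω`. -/
structure FoxbyPair : Prop where
  hom : Nonempty ((ω →ₗ[R] N) ≃ₗ[R] M)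
  tensor : Nonempty (M ⊗[R] ω ≃ₗ[R] N)
  ev : ∀ i, EV R ω N (i + 1)

lemma FoxbyPair.annihilator_eq (h : FoxbyPair R ω M N) :
    Module.annihilator R M = Module.annihilator R N := by
  obtain ⟨e⟩ := h.hom
  obtain ⟨e'⟩ := h.tensor
  apply le_antisymm
  · intro r hr
    rw [← e'.annihilator_eq, Module.mem_annihilator]
    intro t
    induction t with
    | zero => simp
    | add x y hx hy => rw [smul_add, hx, hy, add_zero]
    | tmul m w => rw [smul_tmul', Module.mem_annihilator.1 hr, zero_tmul]
  · intro r hr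
    rw [← e.annihilator_eq, Module.mem_annihilator]
    exact fun φ => LinearMap.ext fun w => Module.mem_annihilator.1 hr _

lemma FoxbyPair.isWeaklyRegular_iff [IsNoetherianRing R] (h : FoxbyPair R ω M N) (hω : Semi R ω)
    [Module.Finite R N] (rs : List R) : IsWeaklyRegular M rs ↔ IsWeaklyRegular N rs := by
  have := hω.fin
  obtain ⟨e⟩ := h.hom
  rw [← e.isWeaklyRegular_congr rs]
  exact ⟨isWeaklyRegular_of_hom hω.bij.1 rs (ModuleCat.of R N) h.ev,
    isWeaklyRegular_hom rs (ModuleCat.of R N) h.ev⟩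

/-- Foxby equivalence preserves the Cohen-Macaulay property. -/
lemma FoxbyPair.isCMModule_iff [IsNoetherianRing R] [IsLocalRing R] (h : FoxbyPair R ω M N)
    (hω : Semi R ω) [Module.Finite R M] [Module.Finite R N] :
    IsCMModule R M ↔ IsCMModule R N := by
  have h1 : Subsingleton M ↔ Subsingleton N := by
    rw [← Module.annihilator_eq_top_iff (R := R), h.annihilator_eq, Module.annihilator_eq_top_iff]
  rw [← not_iff_not, not_subsingleton_iff_nontrivial, not_subsingleton_iff_nontrivial] at h1
  constructor
  · intro hM
    have := h1.1 hM.nontrivial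
    exact hM.of_iff h.annihilator_eq (h.isWeaklyRegular_iff hω)
  · intro hN
    have := h1.2 hN.nontrivial
    exact hN.of_iff h.annihilator_eq.symm fun rs => (h.isWeaklyRegular_iff hω rs).symm

end Foxby

section Linked

variable {R : Type u} [CommRing R] [IsNoetherianRing R] [IsLocalRing R] {a : Ideal R}
  [IsLocalRing (R ⧸ a)] {ω ω' : Type u} [AddCommGroup ω] [Module R ω]
  [AddCommGroup ω'] [Module (R ⧸ a) ω']

lemma isHorizontallyLinked_tensorProduct_canonical (hω : Semi R ω)
    (haCM : (ldepth (R ⧸ a) (R ⧸ a) : WithBot ℕ∞) = ringKrullDim (R ⧸ a))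
    (hω' : IsCanonicalModule (R ⧸ a) ω') (e : ((R ⧸ a) ⊗[R] ω) ≃ₗ[R ⧸ a] ω')
    {M : Type u} [AddCommGroup M] [Module R M] [Module (R ⧸ a) M] [IsScalarTower R (R ⧸ a) M]
    [Module.Finite R M] (hM : IsCMModule R M) (hA : MemAus R ω M)
    (hL : IsHorizontallyLinkedMS (R ⧸ a) M) :
    IsCMModule R (M ⊗[R ⧸ a] ω') ∧ MemBass R ω (M ⊗[R ⧸ a] ω') ∧
      IsHorizontallyLinked (R ⧸ a) ω' (M ⊗[R ⧸ a] ω') ∧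
      Nonempty ((ω' →ₗ[R ⧸ a] M ⊗[R ⧸ a] ω') ≃ₗ[R ⧸ a] M) := by
  have := hω.fin
  have hS := hω'.1.toSemi
  have := hS.fin
  have : Module.Finite (R ⧸ a) M := Module.Finite.of_restrictScalars_finite R _ _
  rw [memAus_iff] at hA
  have T := (tensorChange e M).restrictScalars R
  have : Module.Finite R (M ⊗[R ⧸ a] ω') := Module.Finite.equiv T
  have hB : Bas (stdSyz R ω) (M ⊗[R ⧸ a] ω') := hA.bas.congr T
  have hmk := mk_bijective_change e hA.bij
  have E : (ω' →ₗ[R ⧸ a] M ⊗[R ⧸ a] ω') ≃ₗ[R ⧸ a] M := (LinearEquiv.ofBijective _ hmk).symm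
  have hP : FoxbyPair R ω M (M ⊗[R ⧸ a] ω') :=
    ⟨⟨((homChange e (M ⊗[R ⧸ a] ω')).symm.trans E).restrictScalars R⟩, ⟨T⟩, hB.ev⟩
  refine ⟨(hP.isCMModule_iff hω).1 hM, memBass_iff.2 hB, ?_, ⟨E⟩⟩
  obtain ⟨zs, hzs, -⟩ := exists_maxReg haCM
  obtain ⟨n, hn⟩ := hω'.2.exists_ev
  have ⟨L, _, hL'⟩ := hL
  obtain ⟨rs, h1, h2, h3⟩ := hM.exists_isWeaklyRegular_of_isOmegaTrC hzs.mem hzs.reg hL'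
  exact isHorizontallyLinked_tensorProduct hS hmk ((hA.tv 0).tensorExactTo e)
    (hzs.ev_one_of_isWeaklyRegular hn h1 h2 ((hP.isWeaklyRegular_iff hω rs).1 h3)) hL

lemma isHorizontallyLinkedMS_hom_canonical (hω : Semi R ω)
    (haCM : (ldepth (R ⧸ a) (R ⧸ a) : WithBot ℕ∞) = ringKrullDim (R ⧸ a))
    (hω' : IsCanonicalModule (R ⧸ a) ω') (e : ((R ⧸ a) ⊗[R] ω) ≃ₗ[R ⧸ a] ω')
    {N : Type u} [AddCommGroup N] [Module R N] [Module (R ⧸ a) N] [IsScalarTower R (R ⧸ a) N]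
    [Module.Finite R N] (hN : IsCMModule R N) (hB : MemBass R ω N)
    (hL : IsHorizontallyLinked (R ⧸ a) ω' N) :
    IsCMModule R (ω' →ₗ[R ⧸ a] N) ∧ MemAus R ω (ω' →ₗ[R ⧸ a] N) ∧
      IsHorizontallyLinkedMS (R ⧸ a) (ω' →ₗ[R ⧸ a] N) ∧
      Nonempty ((ω' →ₗ[R ⧸ a] N) ⊗[R ⧸ a] ω' ≃ₗ[R ⧸ a] N) := by
  have := hω.fin
  have hS := hω'.1.toSemi
  have := hS.fin
  have : Module.Finite (R ⧸ a) N := Module.Finite.of_restrictScalars_finite R _ _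
  rw [memBass_iff] at hB
  have H := (homChange e N).restrictScalars R
  have : Module.Finite R (ω' →ₗ[R ⧸ a] N) := Module.Finite.equiv H.symm
  have hA : Aus (stdSyz R ω) (ω' →ₗ[R ⧸ a] N) := hB.aus.congr H.symm
  have hev := evalMap_bijective_change e hB.bij
  have E : (ω' →ₗ[R ⧸ a] N) ⊗[R ⧸ a] ω' ≃ₗ[R ⧸ a] N :=
    (TensorProduct.comm (R ⧸ a) _ _).trans (LinearEquiv.ofBijective _ hev)
  have hP : FoxbyPair R ω (ω' →ₗ[R ⧸ a] N) N :=
    ⟨⟨H.symm⟩, ⟨((tensorChange e _).trans E).restrictScalars R⟩, hB.ev⟩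
  refine ⟨(hP.isCMModule_iff hω).2 hN, memAus_iff.2 hA, ?_, ⟨E⟩⟩
  obtain ⟨zs, hzs, -⟩ := exists_maxReg haCM
  obtain ⟨n, hn⟩ := hω'.2.exists_ev
  have ⟨Q, _, hL'⟩ := hL
  obtain ⟨rs, h1, h2, h3⟩ := hN.exists_isWeaklyRegular_of_isOmegaTrC hzs.mem
    (hS.isWeaklyRegular hzs.reg) hL'
  exact isHorizontallyLinkedMS_hom hS hev.1 ((hA.tv 0).tensorExactTo e)
    (EV.congr_left E.symm (hzs.ev_one_of_isWeaklyRegular hn h1 h2 h3)) hL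

end Linked

end Linkage

open Paper in
/-- Theorem 3.14 = Theorem B: the adjoint equivalence
`M ↦ M ⊗_{R̄} ω_{R̄}`, `N ↦ Hom_{R̄}(ω_{R̄}, N)` between Cohen-Macaulay modules in
the Auslander class linked by `a` and Cohen-Macaulay modules in the Bass class
linked by `a` with respect to `ω_{R̄}`. -/
theorem stmt_7 (R : Type u) [CommRing R] [IsNoetherianRing R] [IsLocalRing R]
    (hCM : (ldepth R R : WithBot ℕ∞) = ringKrullDim R)
    (ω : Type u) [AddCommGroup ω] [Module R ω] (hω : IsCanonicalModule R ω)
    (a : Ideal R) (haCM : IsCMLocalRing (R ⧸ a)) (haQG : IsQuasiGorensteinIdeal R a)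
    (ω' : Type u) [AddCommGroup ω'] [Module (R ⧸ a) ω']
    (hω' : IsCanonicalModule (R ⧸ a) ω') :
    -- (1)
    (∀ (M : Type u) [AddCommGroup M] [Module R M] [Module (R ⧸ a) M]
      [IsScalarTower R (R ⧸ a) M] [Module.Finite R M],
      IsCMModule R M → MemAus R ω M → IsHorizontallyLinkedMS (R ⧸ a) M →
        IsCMModule R (TensorProduct (R ⧸ a) M ω') ∧
        MemBass R ω (TensorProduct (R ⧸ a) M ω') ∧
        IsHorizontallyLinked (R ⧸ a) ω' (TensorProduct (R ⧸ a) M ω') ∧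
        Nonempty ((ω' →ₗ[R ⧸ a] TensorProduct (R ⧸ a) M ω') ≃ₗ[R ⧸ a] M)) ∧
    -- (2)
    (∀ (N : Type u) [AddCommGroup N] [Module R N] [Module (R ⧸ a) N]
      [IsScalarTower R (R ⧸ a) N] [Module.Finite R N],
      IsCMModule R N → MemBass R ω N → IsHorizontallyLinked (R ⧸ a) ω' N →
        IsCMModule R (ω' →ₗ[R ⧸ a] N) ∧
        MemAus R ω (ω' →ₗ[R ⧸ a] N) ∧
        IsHorizontallyLinkedMS (R ⧸ a) (ω' →ₗ[R ⧸ a] N) ∧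
        Nonempty (TensorProduct (R ⧸ a) (ω' →ₗ[R ⧸ a] N) ω' ≃ₗ[R ⧸ a] N)) := by
  obtain ⟨_, haCM⟩ := haCM
  have hC := hω.1.toSemi
  obtain ⟨e⟩ := Linkage.exists_canonical_equiv hCM hω haCM haQG hω'
  exact ⟨fun M _ _ _ _ _ => Linkage.isHorizontallyLinked_tensorProduct_canonical hC haCM hω' e,
    fun N _ _ _ _ _ => Linkage.isHorizontallyLinkedMS_hom_canonical hC haCM hω' e⟩
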